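/- arXiv:1303.1555 — 5 statements merged into one kernel-verified Lean document; each statement's English description precedes it below -/
import Mathlib

section
/- Let s₁, s₂ > 0 and suppose the power series v(t,z) = Σ_{k,n≥0} a_{kn} t^k z^n converges absolutely on the polydisc D_{r₁} × D_{r₂} = {(t,z) ∈ ℂ² : |t| < r₁, |z| < r₂}. Then the series w(t,z) := Σ_{k,n≥0} a_{kn} · (Γ(1+k s₁)Γ(1+n s₂)/Γ(1+k s₁+n s₂)) · t^k z^n also converges absolutely on D_{r₁} × D_{r₂}, and for all (t,z) ∈ D_{r₁} × D_{r₂} one has w(t,z) = (1 + s₁ t ∂_t + s₂ z ∂_z) ∫_0^1 v(t ε^{s₁}, z (1−ε)^{s₂}) dε. -/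
open MeasureTheory

/-- The sum of the double power series `Σ a_{kn} t^k z^n`. -/
noncomputable def vSum (a : ℕ → ℕ → ℂ) (t z : ℂ) : ℂ :=
  ∑' kn : ℕ × ℕ, a kn.1 kn.2 * t ^ kn.1 * z ^ kn.2

/-- The integral `∫_0^1 v(t ε^{s₁}, z(1-ε)^{s₂}) dε`. -/
noncomputable def Fint (s₁ s₂ : ℝ) (a : ℕ → ℕ → ℂ) (t z : ℂ) : ℂ :=
  ∫ ε in (0:ℝ)..1, vSum a (t * ((ε ^ s₁ : ℝ) : ℂ)) (z * (((1 - ε) ^ s₂ : ℝ) : ℂ))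

/-- A double power series converging on a polydisc may be differentiated termwise in the first
variable. -/
lemma hasSum_mul_deriv_vSum_left {r₁ r₂ : ℝ} {c : ℕ → ℕ → ℂ}
    (hc : ∀ t z : ℂ, ‖t‖ < r₁ → ‖z‖ < r₂ →
      Summable fun kn : ℕ × ℕ => c kn.1 kn.2 * t ^ kn.1 * z ^ kn.2)
    {t z : ℂ} (ht : ‖t‖ < r₁) (hz : ‖z‖ < r₂) :
    HasSum (fun kn : ℕ × ℕ => (kn.1 : ℂ) * (c kn.1 kn.2 * t ^ kn.1 * z ^ kn.2))
      (t * deriv (fun t' => vSum c t' z) t) := by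
  obtain ⟨ρ, htρ, hρ⟩ := exists_between ht
  have hρ0 : 0 ≤ ρ := (norm_nonneg t).trans htρ.le
  have hu := (hc (ρ : ℂ) z (by simpa [abs_of_nonneg hρ0] using hρ) hz).norm
  have key := Complex.hasSum_deriv_of_summable_norm (U := Metric.ball (0 : ℂ) ρ)
    (F := fun (kn : ℕ × ℕ) (t' : ℂ) => c kn.1 kn.2 * t' ^ kn.1 * z ^ kn.2)
    hu (fun kn => by fun_prop) Metric.isOpen_ball
    (fun kn w hw => by
      have hw' : ‖w‖ ≤ ρ := (mem_ball_zero_iff.mp hw).le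
      simp only [norm_mul, norm_pow, Complex.norm_real, Real.norm_eq_abs, abs_of_nonneg hρ0]
      gcongr)
    (mem_ball_zero_iff.mpr htρ)
  refine (key.mul_left t).congr_fun ?_
  rintro ⟨k, n⟩
  have hd : deriv (fun t' : ℂ => c k n * t' ^ k * z ^ n) t =
      c k n * (k * t ^ (k - 1)) * z ^ n :=
    (((hasDerivAt_pow k t).const_mul (c k n)).mul_const (z ^ n)).deriv
  simp only [hd]
  rcases k with _ | k
  · simp
  · simp only [Nat.add_sub_cancel, pow_succ]
    ring

lemma vSum_swap (c : ℕ → ℕ → ℂ) (t z : ℂ) : vSum (fun n k => c k n) z t = vSum c t z := by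
  unfold vSum
  rw [← (Equiv.prodComm ℕ ℕ).tsum_eq]
  exact tsum_congr fun kn => mul_right_comm _ _ _

/-- A double power series converging on a polydisc may be differentiated termwise in the second
variable. -/
lemma hasSum_mul_deriv_vSum_right {r₁ r₂ : ℝ} {c : ℕ → ℕ → ℂ}
    (hc : ∀ t z : ℂ, ‖t‖ < r₁ → ‖z‖ < r₂ →
      Summable fun kn : ℕ × ℕ => c kn.1 kn.2 * t ^ kn.1 * z ^ kn.2)
    {t z : ℂ} (ht : ‖t‖ < r₁) (hz : ‖z‖ < r₂) :
    HasSum (fun kn : ℕ × ℕ => (kn.2 : ℂ) * (c kn.1 kn.2 * t ^ kn.1 * z ^ kn.2))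
      (z * deriv (fun z' => vSum c t z') z) := by
  have hc' : ∀ z t : ℂ, ‖z‖ < r₂ → ‖t‖ < r₁ →
      Summable fun nk : ℕ × ℕ => c nk.2 nk.1 * z ^ nk.1 * t ^ nk.2 := fun z t hz ht =>
    ((Equiv.prodComm ℕ ℕ).summable_iff.mpr (hc t z ht hz)).congr
      fun nk => mul_right_comm _ _ _
  have key := hasSum_mul_deriv_vSum_left (c := fun n k => c k n) hc' hz ht
  simp only [vSum_swap] at key
  refine ((Equiv.prodComm ℕ ℕ).hasSum_iff.mpr key).congr_fun fun kn => ?_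
  simp [mul_right_comm]

/-- The Euler beta integral in the form `∫_0^1 ε^x (1-ε)^y dε`. -/
lemma integral_rpow_mul_one_sub_rpow {x y : ℝ} (hx : 0 ≤ x) (hy : 0 ≤ y) :
    ∫ ε in (0:ℝ)..1, ((ε ^ x * (1 - ε) ^ y : ℝ) : ℂ) =
      ((Real.Gamma (1 + x) * Real.Gamma (1 + y) / Real.Gamma (1 + x + y + 1) : ℝ) : ℂ) := by
  have hB := Complex.betaIntegral_eq_Gamma_mul_div ((1 + x : ℝ) : ℂ) ((1 + y : ℝ) : ℂ)
    (by rw [Complex.ofReal_re]; positivity) (by rw [Complex.ofReal_re]; positivity)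
  rw [← Complex.ofReal_add, Complex.Gamma_ofReal, Complex.Gamma_ofReal, Complex.Gamma_ofReal,
    show 1 + x + (1 + y) = 1 + x + y + 1 by ring] at hB
  push_cast at hB ⊢
  rw [← hB, Complex.betaIntegral]
  refine intervalIntegral.integral_congr fun ε hε => ?_
  rw [Set.uIcc_of_le zero_le_one] at hε
  simp only [add_sub_cancel_left]
  rw [Complex.ofReal_cpow hε.1, Complex.ofReal_cpow (sub_nonneg.mpr hε.2)]
  push_cast
  rfl

/-- Termwise integration of `v(t ε^{s₁}, z(1-ε)^{s₂})` over `[0,1]`. -/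
lemma hasSum_Fint {s₁ s₂ : ℝ} (hs₁ : 0 < s₁) (hs₂ : 0 < s₂) {a : ℕ → ℕ → ℂ} {t z : ℂ}
    (h : Summable fun kn : ℕ × ℕ => ‖a kn.1 kn.2‖ * ‖t‖ ^ kn.1 * ‖z‖ ^ kn.2) :
    HasSum (fun kn : ℕ × ℕ => a kn.1 kn.2 *
        ((Real.Gamma (1 + kn.1 * s₁) * Real.Gamma (1 + kn.2 * s₂) /
          Real.Gamma (1 + kn.1 * s₁ + kn.2 * s₂ + 1) : ℝ) : ℂ) * t ^ kn.1 * z ^ kn.2)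
      (Fint s₁ s₂ a t z) := by
  have hbound : ∀ (kn : ℕ × ℕ) (ε : ℝ), ε ∈ Set.uIoc (0:ℝ) 1 →
      ‖a kn.1 kn.2 * (t * ((ε ^ s₁ : ℝ) : ℂ)) ^ kn.1 *
        (z * (((1 - ε) ^ s₂ : ℝ) : ℂ)) ^ kn.2‖ ≤
      ‖a kn.1 kn.2‖ * ‖t‖ ^ kn.1 * ‖z‖ ^ kn.2 := by
    intro kn ε hε
    rw [Set.uIoc_of_le zero_le_one] at hε
    have h0 : 0 ≤ 1 - ε := sub_nonneg.mpr hε.2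
    have h1 : ‖t * ((ε ^ s₁ : ℝ) : ℂ)‖ ≤ ‖t‖ := by
      rw [norm_mul, Complex.norm_real, Real.norm_of_nonneg (Real.rpow_nonneg hε.1.le _)]
      exact mul_le_of_le_one_right (norm_nonneg _) (Real.rpow_le_one hε.1.le hε.2 hs₁.le)
    have h2 : ‖z * (((1 - ε) ^ s₂ : ℝ) : ℂ)‖ ≤ ‖z‖ := by
      rw [norm_mul, Complex.norm_real, Real.norm_of_nonneg (Real.rpow_nonneg h0 _)]
      exact mul_le_of_le_one_right (norm_nonneg _)
        (Real.rpow_le_one h0 (by linarith [hε.1]) hs₂.le)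
    rw [norm_mul, norm_mul, norm_pow, norm_pow]
    gcongr
  have key := intervalIntegral.hasSum_integral_of_dominated_convergence (μ := volume)
    (a := 0) (b := 1)
    (F := fun (kn : ℕ × ℕ) (ε : ℝ) => a kn.1 kn.2 * (t * ((ε ^ s₁ : ℝ) : ℂ)) ^ kn.1 *
      (z * (((1 - ε) ^ s₂ : ℝ) : ℂ)) ^ kn.2)
    (f := fun ε => vSum a (t * ((ε ^ s₁ : ℝ) : ℂ)) (z * (((1 - ε) ^ s₂ : ℝ) : ℂ)))
    (fun kn _ => ‖a kn.1 kn.2‖ * ‖t‖ ^ kn.1 * ‖z‖ ^ kn.2)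
    (fun kn => Measurable.aestronglyMeasurable (by fun_prop))
    (fun kn => Filter.Eventually.of_forall (hbound kn))
    (Filter.Eventually.of_forall fun _ _ => h)
    intervalIntegrable_const
    (Filter.Eventually.of_forall fun ε hε =>
      (Summable.of_norm_bounded h fun kn => hbound kn ε hε).hasSum)
  refine key.congr_fun ?_
  rintro ⟨k, n⟩
  dsimp only
  rw [← integral_rpow_mul_one_sub_rpow (by positivity) (by positivity),
    show ∀ I : ℂ, a k n * I * t ^ k * z ^ n = a k n * t ^ k * z ^ n * I from fun I => by ring,
    ← intervalIntegral.integral_const_mul]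
  refine intervalIntegral.integral_congr fun ε hε => ?_
  rw [Set.uIcc_of_le zero_le_one] at hε
  rw [mul_comm (k : ℝ), mul_comm (n : ℝ), Real.rpow_mul_natCast hε.1,
    Real.rpow_mul_natCast (sub_nonneg.mpr hε.2)]
  push_cast
  ring

/-- If `v(t,z) = Σ a_{kn} t^k z^n` converges absolutely on the polydisc
`D_{r₁} × D_{r₂}`, then the series
`w(t,z) = Σ a_{kn} (Γ(1+ks₁)Γ(1+ns₂)/Γ(1+ks₁+ns₂)) t^k z^n` also converges
absolutely there, and
`w(t,z) = (1 + s₁ t ∂_t + s₂ z ∂_z) ∫_0^1 v(t ε^{s₁}, z(1-ε)^{s₂}) dε`. -/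
theorem stmt3 (s₁ s₂ : ℝ) (hs₁ : 0 < s₁) (hs₂ : 0 < s₂)
    (r₁ r₂ : ℝ) (hr₁ : 0 < r₁) (hr₂ : 0 < r₂) (a : ℕ → ℕ → ℂ)
    (hconv : ∀ t z : ℂ, ‖t‖ < r₁ → ‖z‖ < r₂ →
      Summable fun kn : ℕ × ℕ => ‖a kn.1 kn.2‖ * ‖t‖ ^ kn.1 * ‖z‖ ^ kn.2) :
    (∀ t z : ℂ, ‖t‖ < r₁ → ‖z‖ < r₂ →
      Summable fun kn : ℕ × ℕ =>
        ‖a kn.1 kn.2 * ((Real.Gamma (1 + kn.1 * s₁) * Real.Gamma (1 + kn.2 * s₂) /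
          Real.Gamma (1 + kn.1 * s₁ + kn.2 * s₂) : ℝ) : ℂ)‖ * ‖t‖ ^ kn.1 * ‖z‖ ^ kn.2) ∧
    (∀ t z : ℂ, ‖t‖ < r₁ → ‖z‖ < r₂ →
      (∑' kn : ℕ × ℕ, a kn.1 kn.2 * ((Real.Gamma (1 + kn.1 * s₁) * Real.Gamma (1 + kn.2 * s₂) /
          Real.Gamma (1 + kn.1 * s₁ + kn.2 * s₂) : ℝ) : ℂ) * t ^ kn.1 * z ^ kn.2) =
        Fint s₁ s₂ a t z + (s₁ : ℂ) * t * deriv (fun t' => Fint s₁ s₂ a t' z) t +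
          (s₂ : ℂ) * z * deriv (fun z' => Fint s₁ s₂ a t z') z) := by
  set b : ℕ → ℕ → ℂ := fun k n => a k n *
    ((Real.Gamma (1 + k * s₁) * Real.Gamma (1 + n * s₂) /
      Real.Gamma (1 + k * s₁ + n * s₂ + 1) : ℝ) : ℂ) with hb
  have hF : ∀ t z : ℂ, ‖t‖ < r₁ → ‖z‖ < r₂ →
      HasSum (fun kn : ℕ × ℕ => b kn.1 kn.2 * t ^ kn.1 * z ^ kn.2) (Fint s₁ s₂ a t z) :=
    fun t z ht hz => hasSum_Fint hs₁ hs₂ (hconv t z ht hz)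
  have hbsum : ∀ t z : ℂ, ‖t‖ < r₁ → ‖z‖ < r₂ →
      Summable fun kn : ℕ × ℕ => b kn.1 kn.2 * t ^ kn.1 * z ^ kn.2 :=
    fun t z ht hz => (hF t z ht hz).summable
  have main : ∀ t z : ℂ, ‖t‖ < r₁ → ‖z‖ < r₂ →
      HasSum (fun kn : ℕ × ℕ => a kn.1 kn.2 *
        ((Real.Gamma (1 + kn.1 * s₁) * Real.Gamma (1 + kn.2 * s₂) /
          Real.Gamma (1 + kn.1 * s₁ + kn.2 * s₂) : ℝ) : ℂ) * t ^ kn.1 * z ^ kn.2)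
        (Fint s₁ s₂ a t z + (s₁ : ℂ) * t * deriv (fun t' => Fint s₁ s₂ a t' z) t +
          (s₂ : ℂ) * z * deriv (fun z' => Fint s₁ s₂ a t z') z) := by
    intro t z ht hz
    have ht' : deriv (fun t' => Fint s₁ s₂ a t' z) t = deriv (fun t' => vSum b t' z) t := by
      refine Filter.EventuallyEq.deriv_eq ?_
      filter_upwards [(isOpen_lt continuous_norm continuous_const).mem_nhds ht] with w hw
      exact (hF w z hw hz).tsum_eq.symm
    have hz' : deriv (fun z' => Fint s₁ s₂ a t z') z = deriv (fun z' => vSum b t z') z := by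
      refine Filter.EventuallyEq.deriv_eq ?_
      filter_upwards [(isOpen_lt continuous_norm continuous_const).mem_nhds hz] with w hw
      exact (hF t w ht hw).tsum_eq.symm
    rw [ht', hz', mul_assoc, mul_assoc]
    refine (((hF t z ht hz).add
      ((hasSum_mul_deriv_vSum_left hbsum ht hz).mul_left (s₁ : ℂ))).add
      ((hasSum_mul_deriv_vSum_right hbsum ht hz).mul_left (s₂ : ℂ))).congr_fun ?_
    rintro ⟨k, n⟩
    have hx : 0 < 1 + k * s₁ + n * s₂ := by positivity
    have hG : Real.Gamma (1 + k * s₁) * Real.Gamma (1 + n * s₂) /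
        Real.Gamma (1 + k * s₁ + n * s₂) = (1 + k * s₁ + n * s₂) *
        (Real.Gamma (1 + k * s₁) * Real.Gamma (1 + n * s₂) /
          Real.Gamma (1 + k * s₁ + n * s₂ + 1)) := by
      rw [Real.Gamma_add_one hx.ne']
      have := (Real.Gamma_pos_of_pos hx).ne'
      field_simp
    simp only [hb]
    rw [hG, Complex.ofReal_mul]
    push_cast
    ring
  exact ⟨fun t z ht hz => by simpa only [norm_mul, norm_pow] using (main t z ht hz).summable.norm,
    fun t z ht hz => (main t z ht hz).tsum_eq⟩
end

section
/- Let s, s₁ ∈ ℝ and let m : ℕ → ℂ∖{0} satisfy c^n Γ_s(n) ≤ |m(n)| ≤ C^n Γ_s(n) for all n ∈ ℕ and some constants c, C > 0 (this holds for every moment function m of order s). Then a formal power series û = Σ_n a_n x^n ∈ ℂ[[x]] has Gevrey order s₁ if and only if its m-moment Borel transform B_{m,x} û = Σ_n (a_n/m(n)) x^n has Gevrey order s₁ − s. -/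
/-- `Γ_s(n) := Γ(1+sn)` for `s ≥ 0` and `Γ_s(n) := 1/Γ(1-sn)` for `s < 0`. -/
noncomputable def GammaS (s : ℝ) (n : ℕ) : ℝ :=
  if 0 ≤ s then Real.Gamma (1 + s * n) else (Real.Gamma (1 - s * n))⁻¹

/-- A formal power series `Σ a_n x^n` has Gevrey order `s` iff
`|a_n| ≤ C A^n Γ_s(n)` for some `C, A > 0`. -/
def HasGevreyOrder (s : ℝ) (a : ℕ → ℂ) : Prop :=
  ∃ C > (0:ℝ), ∃ A > (0:ℝ), ∀ n : ℕ, ‖a n‖ ≤ C * A ^ n * GammaS s n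

open Real MeasureTheory Set

lemma rpow_mul_exp_neg_le_Gamma {x : ℝ} (hx : 0 < x) : x ^ x * exp (-x) ≤ Gamma (1 + x) := by
  have hint : IntegrableOn (fun t : ℝ => exp (-t) * t ^ (1 + x - 1)) (Ioi 0) :=
    GammaIntegral_convergent (by linarith)
  rw [Gamma_eq_integral (by linarith), ← integral_exp_neg_Ioi, ← integral_const_mul]
  calc ∫ t in Ioi x, x ^ x * exp (-t)
      ≤ ∫ t in Ioi x, exp (-t) * t ^ (1 + x - 1) := by
        refine setIntegral_mono_on ((integrableOn_exp_neg_Ioi x).const_mul _)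
          (hint.mono_set (Ioi_subset_Ioi hx.le)) measurableSet_Ioi fun t ht => ?_
        rw [mul_comm, add_sub_cancel_left]
        gcongr
        exact (mem_Ioi.mp ht).le
    _ ≤ ∫ t in Ioi 0, exp (-t) * t ^ (1 + x - 1) := by
        refine setIntegral_mono_set hint ?_ (Ioi_subset_Ioi hx.le).eventuallyLE
        filter_upwards [ae_restrict_mem measurableSet_Ioi] with t ht
        have ht' : 0 < t := ht
        simp only [Pi.zero_apply]
        positivity

lemma log_Gamma_one_add_le {x : ℝ} (hx : 0 < x) :
    log (Gamma (1 + x)) ≤ x * log (1 + x) := by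
  have h := convexOn_log_Gamma.slope_mono_adjacent (x := 1) (y := 1 + x) (z := 1 + x + 1)
    (by simp) (by simp only [mem_Ioi]; linarith) (by linarith) (by linarith)
  have hlog : log (Gamma (1 + x + 1)) = log (1 + x) + log (Gamma (1 + x)) := by
    rw [Gamma_add_one (by linarith), log_mul (by linarith) (Gamma_pos_of_pos (by linarith)).ne']
  simp only [Function.comp_apply, hlog, Gamma_one, log_one, sub_zero, add_sub_cancel_left,
    add_sub_cancel_right, div_one] at h
  rw [div_le_iff₀ hx] at h
  linarith

/-- A weak form of Stirling's formula. -/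
lemma abs_log_Gamma_one_add_sub_le {x : ℝ} (hx : 0 ≤ x) :
    |log (Gamma (1 + x)) - x * log x| ≤ x + 1 := by
  rcases hx.eq_or_lt with rfl | hx
  · simp
  rw [abs_le]
  constructor
  · have h := log_le_log (by positivity) (rpow_mul_exp_neg_le_Gamma hx)
    rw [log_mul (by positivity) (by positivity), log_rpow hx, log_exp] at h
    linarith
  · have h := log_Gamma_one_add_le hx
    have hdiv : log (1 + x) - log x ≤ 1 / x := by
      rw [← log_div (by positivity) hx.ne']
      refine (log_le_sub_one_of_pos (by positivity)).trans_eq ?_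
      field_simp
      ring
    have hmul := mul_le_mul_of_nonneg_left hdiv hx.le
    rw [mul_one_div_cancel hx.ne'] at hmul
    linarith

lemma exists_abs_log_Gamma_one_add_mul_sub_le {s : ℝ} (hs : 0 ≤ s) :
    ∃ B : ℝ, ∀ n : ℕ, |log (Gamma (1 + s * n)) - s * (n * log n)| ≤ B * (n + 1) := by
  refine ⟨s + 1 + |s * log s|, fun n => ?_⟩
  have hn : (0 : ℝ) ≤ n := n.cast_nonneg
  have h := abs_log_Gamma_one_add_sub_le (mul_nonneg hs hn)
  have hsplit : s * n * log (s * n) = s * (n * log n) + n * (s * log s) := by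
    rcases hs.eq_or_lt with rfl | hs
    · simp
    rcases hn.eq_or_lt with hn | hn
    · simp [← hn]
    rw [log_mul hs.ne' hn.ne']
    ring
  calc |log (Gamma (1 + s * n)) - s * (n * log n)|
      = |(log (Gamma (1 + s * n)) - s * n * log (s * n)) + n * (s * log s)| := by
        rw [hsplit]; ring_nf
    _ ≤ (s * n + 1) + n * |s * log s| := by
        refine (abs_add_le _ _).trans (add_le_add h ?_)
        rw [abs_mul, abs_of_nonneg hn]
    _ ≤ (s + 1 + |s * log s|) * (n + 1) := by
        nlinarith [abs_nonneg (s * log s)]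

lemma GammaS_pos (s : ℝ) (n : ℕ) : 0 < GammaS s n := by
  have hn : (0 : ℝ) ≤ n := n.cast_nonneg
  unfold GammaS
  split_ifs with hs
  · exact Gamma_pos_of_pos (by positivity)
  · exact inv_pos.mpr (Gamma_pos_of_pos (by nlinarith))

lemma exists_abs_log_GammaS_sub_le (s : ℝ) :
    ∃ B : ℝ, ∀ n : ℕ, |log (GammaS s n) - s * (n * log n)| ≤ B * (n + 1) := by
  by_cases hs : 0 ≤ s
  · simpa only [GammaS, if_pos hs] using exists_abs_log_Gamma_one_add_mul_sub_le hs
  · obtain ⟨B, hB⟩ := exists_abs_log_Gamma_one_add_mul_sub_le (s := -s) (by linarith)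
    refine ⟨B, fun n => ?_⟩
    rw [GammaS, if_neg hs, log_inv, abs_sub_comm]
    convert hB n using 2
    ring_nf

lemma pow_eq_exp_mul_log {A : ℝ} (hA : 0 < A) (n : ℕ) : A ^ n = exp (n * log A) := by
  rw [exp_nat_mul, exp_log hA]

lemma exists_pow_mul_GammaS_le (s : ℝ) {A : ℝ} (hA : 0 < A) :
    ∃ B : ℝ, ∀ n : ℕ, A ^ n * GammaS s n ≤ exp (B * (n + 1) + s * (n * log n)) := by
  obtain ⟨B, hB⟩ := exists_abs_log_GammaS_sub_le s
  refine ⟨B + |log A|, fun n => ?_⟩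
  rw [← exp_log (GammaS_pos s n), pow_eq_exp_mul_log hA, ← exp_add, exp_le_exp]
  have hn : (0 : ℝ) ≤ n := n.cast_nonneg
  nlinarith [(abs_le.mp (hB n)).2, le_abs_self (log A), abs_nonneg (log A)]

lemma exists_le_pow_mul_GammaS (s : ℝ) {A : ℝ} (hA : 0 < A) :
    ∃ B : ℝ, ∀ n : ℕ, exp (-(B * (n + 1)) + s * (n * log n)) ≤ A ^ n * GammaS s n := by
  obtain ⟨B, hB⟩ := exists_abs_log_GammaS_sub_le s
  refine ⟨B + |log A|, fun n => ?_⟩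
  rw [← exp_log (GammaS_pos s n), pow_eq_exp_mul_log hA, ← exp_add, exp_le_exp]
  have hn : (0 : ℝ) ≤ n := n.cast_nonneg
  nlinarith [(abs_le.mp (hB n)).1, neg_abs_le (log A), abs_nonneg (log A)]

lemma hasGevreyOrder_iff_exists_le_exp (s : ℝ) (a : ℕ → ℂ) :
    HasGevreyOrder s a ↔
      ∃ B : ℝ, ∀ n : ℕ, ‖a n‖ ≤ exp (B * (n + 1) + s * (n * log n)) := by
  constructor
  · rintro ⟨C, hC, A, hA, h⟩
    obtain ⟨B, hB⟩ := exists_pow_mul_GammaS_le s hA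
    refine ⟨B + |log C|, fun n => (h n).trans ?_⟩
    rw [mul_assoc]
    refine (mul_le_mul_of_nonneg_left (hB n) hC.le).trans ?_
    nth_rewrite 1 [← exp_log hC]
    rw [← exp_add, exp_le_exp]
    have hn : (0 : ℝ) ≤ n := n.cast_nonneg
    nlinarith [le_abs_self (log C), abs_nonneg (log C)]
  · rintro ⟨B, h⟩
    obtain ⟨D, hD⟩ := exists_le_pow_mul_GammaS s one_pos
    refine ⟨exp (B + D), exp_pos _, exp (B + D), exp_pos _, fun n => (h n).trans ?_⟩
    have hDn := hD n
    rw [one_pow, one_mul] at hDn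
    refine le_trans (le_of_eq ?_) (mul_le_mul_of_nonneg_left hDn (by positivity))
    rw [← exp_nat_mul, ← exp_add, ← exp_add]
    ring_nf

/-- If `m` is comparable to `Γ_s` (as every moment function of order `s` is),
then `û` has Gevrey order `s₁` iff its `m`-moment Borel transform has Gevrey
order `s₁ - s`. -/
theorem stmt7 (s s₁ : ℝ) (m : ℕ → ℂ) (hm0 : ∀ n, m n ≠ 0)
    (c C : ℝ) (hc : 0 < c) (hC : 0 < C)
    (hm : ∀ n : ℕ, c ^ n * GammaS s n ≤ ‖m n‖ ∧ ‖m n‖ ≤ C ^ n * GammaS s n)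
    (a : ℕ → ℂ) :
    HasGevreyOrder s₁ a ↔ HasGevreyOrder (s₁ - s) (fun n => a n / m n) := by
  simp only [hasGevreyOrder_iff_exists_le_exp, norm_div]
  have hpos (n : ℕ) : 0 < ‖m n‖ := norm_pos_iff.mpr (hm0 n)
  constructor
  · rintro ⟨B, hB⟩
    obtain ⟨D, hD⟩ := exists_le_pow_mul_GammaS s hc
    refine ⟨B + D, fun n => (div_le_iff₀ (hpos n)).mpr ((hB n).trans ?_)⟩
    refine le_trans (le_of_eq ?_)
      (mul_le_mul_of_nonneg_left ((hD n).trans (hm n).1) (exp_pos _).le)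
    rw [← exp_add]
    ring_nf
  · rintro ⟨B, hB⟩
    obtain ⟨D, hD⟩ := exists_pow_mul_GammaS_le s hC
    refine ⟨B + D, fun n => ((div_le_iff₀ (hpos n)).mp (hB n)).trans ?_⟩
    refine (mul_le_mul_of_nonneg_left ((hm n).2.trans (hD n)) (exp_pos _).le).trans_eq ?_
    rw [← exp_add]
    ring_nf
end

section
/- Let q ∈ ℕ, q ≥ 2, and let φ be holomorphic on a disc D_R = {z ∈ ℂ : |z| < R}. Then the following are equivalent: (i) there exist ρ, r > 0 with r < R such that the series u(t,z) = Σ_{j=0}^∞ φ^{(qj)}(z) t^j / j! converges absolutely for all |t| < ρ, |z| < r (so that the solution of ∂_t u = ∂_z^q u, u(0,·) = φ, is analytic in t in a complex neighbourhood of the origin); (ii) φ extends to an entire function on ℂ of exponential growth of order at most q/(q−1), i.e. there exist A, B > 0 with |φ(z)| ≤ A e^{B|z|^{q/(q−1)}} for all z ∈ ℂ. -/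
open Metric Set Filter Topology

/-- A power series whose coefficients decay faster than every geometric sequence defines an
entire function, with explicit control of its growth. -/
theorem differentiable_tsum_and_norm_le_of_coeff_bound {c : ℕ → ℂ} {H : ℝ → ℝ} (a : ℂ)
    (hc : ∀ n : ℕ, ∀ x : ℝ, 0 ≤ x → ‖c n‖ * x ^ n ≤ H x) :
    Differentiable ℂ (fun z => ∑' n, c n * (z - a) ^ n) ∧
      ∀ z, ‖∑' n, c n * (z - a) ^ n‖ ≤ 2 * H (2 * ‖z - a‖) := by
  have hterm : ∀ (n : ℕ) (x : ℝ), 0 ≤ x → ‖c n‖ * x ^ n ≤ H (2 * x) * (1 / 2) ^ n := by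
    intro n x hx
    have h := hc n (2 * x) (by positivity)
    calc ‖c n‖ * x ^ n = ‖c n‖ * (2 * x) ^ n * (1 / 2) ^ n := by
          rw [mul_assoc, ← mul_pow]; ring_nf
      _ ≤ _ := by gcongr
  have hgeom : ∀ K : ℝ, HasSum (fun n : ℕ => K * (1 / 2) ^ n) (2 * K) := fun K => by
    simpa [mul_comm] using hasSum_geometric_two.mul_left K
  constructor
  · intro z
    have hd : DifferentiableOn ℂ (fun z => ∑' n, c n * (z - a) ^ n) (ball a (‖z - a‖ + 1)) := by
      refine Complex.differentiableOn_tsum_of_summable_norm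
        (hgeom (H (2 * (‖z - a‖ + 1)))).summable (fun n => by fun_prop) isOpen_ball ?_
      intro n w hw
      rw [mem_ball_iff_norm] at hw
      rw [norm_mul, norm_pow]
      refine le_trans ?_ (hterm n _ (by positivity))
      gcongr
    exact hd.differentiableAt (isOpen_ball.mem_nhds (by simp [dist_eq_norm]))
  · intro z
    refine tsum_of_norm_bounded (hgeom _) fun n => ?_
    rw [norm_mul, norm_pow]
    exact hterm n _ (norm_nonneg _)

theorem factorial_pow_le_factorial_mul (m j : ℕ) :
    (j.factorial) ^ m ≤ (m * j).factorial := by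
  induction m with
  | zero => simp
  | succ m ih =>
    calc j.factorial ^ (m + 1) ≤ (m * j).factorial * j.factorial := by
          rw [pow_succ]; gcongr
      _ ≤ _ := by
          rw [add_mul, one_mul]
          exact Nat.le_of_dvd (Nat.factorial_pos _)
            (Nat.factorial_mul_factorial_dvd_factorial_add _ _)

theorem factorial_mul_pow_div_factorial_le_exp (p : ℕ) {M x y : ℝ} (hy : 0 ≤ y)
    (hyx : y ^ p = M * x ^ (p + 1)) (j : ℕ) :
    j.factorial * M ^ j * x ^ ((p + 1) * j) / ((p + 1) * j).factorial ≤ Real.exp (p * y) := by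
  have hfac : (j.factorial : ℝ) ^ p * j.factorial ≤ ((p + 1) * j).factorial := by
    rw [← pow_succ]
    exact_mod_cast factorial_pow_le_factorial_mul (p + 1) j
  have hj : (0 : ℝ) < j.factorial := by positivity
  have hpow : M ^ j * x ^ ((p + 1) * j) = (y ^ j) ^ p := by
    rw [pow_mul, ← mul_pow, ← hyx, ← pow_mul, ← pow_mul, mul_comm]
  calc j.factorial * M ^ j * x ^ ((p + 1) * j) / ((p + 1) * j).factorial
      = j.factorial * (y ^ j) ^ p / ((p + 1) * j).factorial := by rw [mul_assoc, hpow]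
    _ ≤ j.factorial * (y ^ j) ^ p / ((j.factorial : ℝ) ^ p * j.factorial) := by gcongr
    _ = (y ^ j / j.factorial) ^ p := by rw [div_pow]; field_simp
    _ ≤ Real.exp y ^ p := by
        gcongr
        exact Real.pow_div_factorial_le_exp y hy j
    _ = Real.exp (p * y) := (Real.exp_nat_mul y p).symm

theorem add_rpow_le_two_rpow_mul {x y k : ℝ} (hx : 0 ≤ x) (hy : 0 ≤ y) (hk : 0 ≤ k) :
    (x + y) ^ k ≤ 2 ^ k * (x ^ k + y ^ k) := by
  have hx' : 0 ≤ x ^ k := by positivity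
  have hy' : 0 ≤ y ^ k := by positivity
  rcases le_total x y with h | h
  · calc (x + y) ^ k ≤ (2 * y) ^ k := by gcongr; linarith
      _ = 2 ^ k * y ^ k := Real.mul_rpow (by norm_num) hy
      _ ≤ _ := by gcongr; linarith
  · calc (x + y) ^ k ≤ (2 * x) ^ k := by gcongr; linarith
      _ = 2 ^ k * x ^ k := Real.mul_rpow (by norm_num) hx
      _ ≤ _ := by gcongr; linarith

/-- Pointwise bounds on a sequence of functions continuous on a ball are locally uniform
somewhere in the ball. -/
theorem exists_ball_uniform_bound {F : ℕ → ℂ → ℝ} {r : ℝ} (hr : 0 < r)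
    (hF : ∀ j, ContinuousOn (F j) (closedBall 0 r))
    (hb : ∀ z ∈ closedBall (0 : ℂ) r, ∃ N : ℕ, ∀ j, F j z ≤ N) :
    ∃ N : ℕ, ∃ a : ℂ, ∃ ε > 0, closedBall a ε ⊆ ball 0 r ∧
      ∀ z ∈ closedBall a ε, ∀ j, F j z ≤ N := by
  let E : ℕ → Set ℂ := fun N => (ball 0 r)ᶜ ∪ ⋂ j, closedBall 0 r ∩ F j ⁻¹' Iic (N : ℝ)
  have hE : ∀ N, IsClosed (E N) := fun N =>
    isOpen_ball.isClosed_compl.union <| isClosed_iInter fun j =>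
      (hF j).preimage_isClosed_of_isClosed isClosed_closedBall isClosed_Iic
  have hU : ⋃ N, E N = univ := by
    refine eq_univ_of_forall fun z => mem_iUnion.2 ?_
    by_cases hz : z ∈ ball (0 : ℂ) r
    · obtain ⟨N, hN⟩ := hb z (ball_subset_closedBall hz)
      exact ⟨N, Or.inr (mem_iInter.2 fun j => ⟨ball_subset_closedBall hz, hN j⟩)⟩
    · exact ⟨0, Or.inl hz⟩
  obtain ⟨a, ha, haE⟩ := (dense_iUnion_interior_of_closed hE hU).inter_open_nonempty _
    (isOpen_ball (x := (0 : ℂ)) (ε := r)) ⟨0, mem_ball_self hr⟩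
  obtain ⟨N, hN⟩ := mem_iUnion.1 haE
  obtain ⟨ε, hε, hsub⟩ := nhds_basis_closedBall.mem_iff.1
    (inter_mem (isOpen_ball.mem_nhds ha) (isOpen_interior.mem_nhds hN))
  refine ⟨N, a, ε, hε, fun z hz => (hsub hz).1, fun z hz j => ?_⟩
  rcases interior_subset (hsub hz).2 with h | h
  · exact absurd (hsub hz).1 h
  · exact (mem_iInter.1 h j).2

theorem analyticOnNhd_iteratedDeriv {f : ℂ → ℂ} {s : Set ℂ} (hs : IsOpen s)
    (hf : DifferentiableOn ℂ f s) (n : ℕ) : AnalyticOnNhd ℂ (iteratedDeriv n f) s := by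
  rw [iteratedDeriv_eq_iterate]
  exact (hf.analyticOnNhd hs).iterated_deriv n

/-- If the derivatives of order divisible by `p + 1` grow like `j! M ^ j` uniformly on a disc,
then all Taylor coefficients at the centre are those of an entire function of order at most
`(p + 1) / p`. -/
theorem norm_taylor_coeff_mul_pow_le {f : ℂ → ℂ} {a : ℂ} {p : ℕ} {ε M C : ℝ} (hε : 0 < ε)
    (hM : 0 ≤ M) (hC : 0 ≤ C)
    (hf : ∀ m, DiffContOnCl ℂ (iteratedDeriv m f) (ball a ε))
    (hb : ∀ z ∈ closedBall a ε, ∀ j : ℕ,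
      ‖iteratedDeriv ((p + 1) * j) f z‖ ≤ C * (j.factorial * M ^ j))
    (n : ℕ) {x y : ℝ} (hx : 0 ≤ x) (hy : 0 ≤ y) (hyx : y ^ p = M * x ^ (p + 1)) :
    ‖(n.factorial : ℂ)⁻¹ * iteratedDeriv n f a‖ * x ^ n ≤
      C * Real.exp ((p + 1 : ℕ) * (x / ε)) * Real.exp (p * y) := by
  obtain ⟨j, k, hk, rfl⟩ : ∃ j k, k ≤ p + 1 ∧ n = (p + 1) * j + k :=
    ⟨n / (p + 1), n % (p + 1), (Nat.mod_lt _ p.succ_pos).le, (Nat.div_add_mod _ _).symm⟩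
  have hderiv : ‖iteratedDeriv ((p + 1) * j + k) f a‖ ≤
      k.factorial * (C * (j.factorial * M ^ j)) / ε ^ k := by
    have h := Complex.norm_iteratedDeriv_le_of_forall_mem_sphere_norm_le k hε
      (hf ((p + 1) * j)) fun z hz => hb z (sphere_subset_closedBall hz) j
    rwa [iteratedDeriv_eq_iterate, iteratedDeriv_eq_iterate, ← Function.iterate_add_apply,
      ← iteratedDeriv_eq_iterate, add_comm k] at h
  have hfac : (((p + 1) * j).factorial : ℝ) * k.factorial ≤ ((p + 1) * j + k).factorial := by
    exact_mod_cast Nat.le_of_dvd (Nat.factorial_pos _)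
      (Nat.factorial_mul_factorial_dvd_factorial_add _ _)
  have hpow : (x / ε) ^ k ≤ Real.exp ((p + 1 : ℕ) * (x / ε)) := by
    have hxε : 0 ≤ x / ε := by positivity
    calc (x / ε) ^ k ≤ (x / ε + 1) ^ k := by gcongr; linarith
      _ ≤ (x / ε + 1) ^ (p + 1) := pow_le_pow_right₀ (by linarith) hk
      _ ≤ Real.exp (x / ε) ^ (p + 1) := by gcongr; exact Real.add_one_le_exp _
      _ = _ := (Real.exp_nat_mul _ _).symm
  have hmain := factorial_mul_pow_div_factorial_le_exp p hy hyx j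
  rw [norm_mul, norm_inv, Complex.norm_natCast]
  calc (((p + 1) * j + k).factorial : ℝ)⁻¹ * ‖iteratedDeriv ((p + 1) * j + k) f a‖
        * x ^ ((p + 1) * j + k)
      ≤ (((p + 1) * j).factorial * k.factorial : ℝ)⁻¹ *
        (k.factorial * (C * (j.factorial * M ^ j)) / ε ^ k) * x ^ ((p + 1) * j + k) := by
        gcongr
    _ = C * (x / ε) ^ k *
        (j.factorial * M ^ j * x ^ ((p + 1) * j) / ((p + 1) * j).factorial) := by
        rw [pow_add, div_pow]
        field_simp
    _ ≤ _ := by gcongr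

/-- Absorbs a linear term and a shift of the centre into a growth bound of order `k ≥ 1`. -/
theorem exists_exp_growth_bound {k α β A : ℝ} (hk : 1 ≤ k) (hα : 0 ≤ α) (hβ : 0 ≤ β) (hA : 0 < A)
    (a : ℂ) : ∃ A' > 0, ∃ B > 0, ∀ z : ℂ,
      A * Real.exp (α * ‖z - a‖ + β * ‖z - a‖ ^ k) ≤ A' * Real.exp (B * ‖z‖ ^ k) := by
  have hk0 : 0 ≤ k := by linarith
  refine ⟨A * Real.exp (α + (α + β) * (2 ^ k * ‖a‖ ^ k)), by positivity,
    (α + β) * 2 ^ k + 1, by positivity, fun z => ?_⟩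
  rw [mul_assoc, ← Real.exp_add]
  have hlin : ‖z - a‖ ≤ 1 + ‖z - a‖ ^ k := by
    rcases le_total ‖z - a‖ 1 with h | h
    · have : 0 ≤ ‖z - a‖ ^ k := by positivity
      linarith
    · have := Real.rpow_le_rpow_of_exponent_le h hk
      rw [Real.rpow_one] at this
      linarith
  have hshift : ‖z - a‖ ^ k ≤ 2 ^ k * (‖z‖ ^ k + ‖a‖ ^ k) :=
    (Real.rpow_le_rpow (norm_nonneg _) (norm_sub_le z a) hk0).trans
      (add_rpow_le_two_rpow_mul (norm_nonneg _) (norm_nonneg _) hk0)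
  have hz : 0 ≤ ‖z‖ ^ k := by positivity
  refine mul_le_mul_of_nonneg_left (Real.exp_le_exp.2 ?_) hA.le
  calc α * ‖z - a‖ + β * ‖z - a‖ ^ k ≤ α * (1 + ‖z - a‖ ^ k) + β * ‖z - a‖ ^ k := by gcongr
    _ = α + (α + β) * ‖z - a‖ ^ k := by ring
    _ ≤ α + (α + β) * (2 ^ k * (‖z‖ ^ k + ‖a‖ ^ k)) := by gcongr
    _ ≤ _ := by linarith

theorem exists_entire_extension_of_summable {p : ℕ} (hp : 1 ≤ p) {R : ℝ} {φ : ℂ → ℂ}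
    (hφ : DifferentiableOn ℂ φ (ball 0 R)) {ρ r : ℝ} (hρ : 0 < ρ) (hr : 0 < r) (hrR : r < R)
    (hsum : ∀ t z : ℂ, ‖t‖ < ρ → ‖z‖ < r →
      Summable fun j : ℕ => ‖iteratedDeriv ((p + 1) * j) φ z‖ * ‖t‖ ^ j / (j.factorial : ℝ)) :
    ∃ g : ℂ → ℂ, Differentiable ℂ g ∧ (∀ z ∈ ball (0 : ℂ) R, g z = φ z) ∧
      ∃ A > (0 : ℝ), ∃ B > (0 : ℝ), ∀ z : ℂ,
        ‖g z‖ ≤ A * Real.exp (B * ‖z‖ ^ (((p : ℝ) + 1) / p)) := by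
  have hp0 : (0 : ℝ) < p := by exact_mod_cast hp
  have han := analyticOnNhd_iteratedDeriv isOpen_ball hφ
  have hsub : closedBall (0 : ℂ) (r / 2) ⊆ ball 0 R := closedBall_subset_ball (by linarith)
  obtain ⟨N, a, ε, hε, hball, hbound⟩ := exists_ball_uniform_bound
    (F := fun j z => ‖iteratedDeriv ((p + 1) * j) φ z‖ * (ρ / 2) ^ j / (j.factorial : ℝ))
    (half_pos hr)
    (fun j => (((han _).continuousOn.mono hsub).norm.mul_const _).div_const _) (by
      intro z hz
      rw [mem_closedBall_zero_iff] at hz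
      have hnorm : ‖((ρ / 2 : ℝ) : ℂ)‖ = ρ / 2 := by
        rw [Complex.norm_real, Real.norm_of_nonneg (by positivity)]
      have hs := hsum ((ρ / 2 : ℝ) : ℂ) z (by rw [hnorm]; linarith) (by linarith)
      rw [hnorm] at hs
      obtain ⟨N, hN⟩ := exists_nat_ge (∑' j : ℕ,
        ‖iteratedDeriv ((p + 1) * j) φ z‖ * (ρ / 2) ^ j / (j.factorial : ℝ))
      exact ⟨N, fun j => (hs.le_tsum j fun i _ => by positivity).trans hN⟩)
  have hballR : closedBall a ε ⊆ ball 0 R :=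
    hball.trans (ball_subset_closedBall.trans hsub)
  set M : ℝ := 2 / ρ with hM
  have hMpos : 0 < M := by positivity
  have hb : ∀ z ∈ closedBall a ε, ∀ j : ℕ,
      ‖iteratedDeriv ((p + 1) * j) φ z‖ ≤ (N + 1) * (j.factorial * M ^ j) := by
    intro z hz j
    have h := hbound z hz j
    rw [div_le_iff₀ (by positivity), ← le_div_iff₀ (by positivity)] at h
    calc _ ≤ _ := h
      _ = N * (j.factorial * M ^ j) := by
        rw [hM, div_pow, div_pow]
        field_simp
      _ ≤ _ := by gcongr; linarith
  set k : ℝ := ((p : ℝ) + 1) / p with hk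
  have hk1 : 1 ≤ k := by rw [hk, one_le_div hp0]; linarith
  set c : ℕ → ℂ := fun n => (n.factorial : ℂ)⁻¹ * iteratedDeriv n φ a
  set H : ℝ → ℝ := fun x => (N + 1) * Real.exp ((p + 1 : ℕ) * (x / ε)) *
    Real.exp (p * (M ^ (1 / p : ℝ) * x ^ k))
  have hcoeff : ∀ n : ℕ, ∀ x : ℝ, 0 ≤ x → ‖c n‖ * x ^ n ≤ H x := by
    intro n x hx
    refine norm_taylor_coeff_mul_pow_le hε hMpos.le (by positivity)
      (fun m => ((han m).differentiableOn.mono hballR).diffContOnCl_ball subset_rfl) hb n hx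
      (by positivity) ?_
    rw [mul_pow, ← Real.rpow_mul_natCast hMpos.le, ← Real.rpow_mul_natCast hx, hk,
      div_mul_cancel₀ _ hp0.ne', div_mul_cancel₀ _ hp0.ne', Real.rpow_one]
    congr 1
    exact_mod_cast Real.rpow_natCast x (p + 1)
  obtain ⟨hg, hgrowth⟩ := differentiable_tsum_and_norm_le_of_coeff_bound a hcoeff
  refine ⟨_, hg, ?_, ?_⟩
  · refine AnalyticOnNhd.eqOn_of_preconnected_of_eventuallyEq
      (hg.differentiableOn.analyticOnNhd isOpen_ball) (hφ.analyticOnNhd isOpen_ball)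
      (convex_ball 0 R).isPreconnected (hballR (mem_closedBall_self hε.le)) ?_
    filter_upwards [ball_mem_nhds a hε] with z hz
    exact Complex.taylorSeries_eq_on_ball' hz (hφ.mono (ball_subset_closedBall.trans hballR))
  · obtain ⟨A, hA, B, hB, h⟩ := exists_exp_growth_bound (k := k) (A := 2 * (N + 1))
      (α := (p + 1 : ℕ) * (2 / ε)) (β := p * (M ^ (1 / p : ℝ) * 2 ^ k)) hk1 (by positivity)
      (by positivity) (by positivity) a
    refine ⟨A, hA, B, hB, fun z => (hgrowth z).trans (le_trans (le_of_eq ?_) (h z))⟩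
    simp only [H]
    rw [Real.exp_add, Real.mul_rpow zero_le_two (norm_nonneg _)]
    ring_nf

/-- Cauchy estimates for an entire function of order at most `(p + 1) / p`, with the radius
optimised for the derivative of order `(p + 1) * j`. -/
theorem norm_iteratedDeriv_le_of_exp_growth {p : ℕ} (hp : 1 ≤ p) {g : ℂ → ℂ}
    (hg : Differentiable ℂ g) {A B k : ℝ} (hA : 0 < A) (hB : 0 < B) (hk : k = ((p : ℝ) + 1) / p)
    (hgrowth : ∀ z, ‖g z‖ ≤ A * Real.exp (B * ‖z‖ ^ k)) {r : ℝ} {z : ℂ} (hz : ‖z‖ ≤ r) (j : ℕ) :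
    ‖iteratedDeriv ((p + 1) * j) g z‖ ≤ A * Real.exp (B * 2 ^ k * r ^ k) *
      (((p : ℝ) + 1) ^ p * Real.exp (B * 2 ^ k)) ^ j * j.factorial := by
  have hp0 : (0 : ℝ) < p := by exact_mod_cast hp
  have hk0 : 0 < k := by rw [hk]; positivity
  have hr : 0 ≤ r := (norm_nonneg z).trans hz
  rcases Nat.eq_zero_or_pos j with rfl | hj
  · simp only [mul_zero, iteratedDeriv_zero, pow_zero, mul_one, Nat.factorial_zero, Nat.cast_one]
    refine (hgrowth z).trans ?_
    have h2 : (1 : ℝ) ≤ 2 ^ k := Real.one_le_rpow one_le_two hk0.le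
    gcongr
    nlinarith
  have hj0 : (0 : ℝ) < j := by exact_mod_cast hj
  set s : ℝ := (j : ℝ) ^ (1 / k) with hs
  have hspos : 0 < s := by positivity
  have hsk : s ^ k = j := by
    rw [hs, ← Real.rpow_mul hj0.le, one_div_mul_cancel hk0.ne', Real.rpow_one]
  have hspow : s ^ ((p + 1) * j) = (j : ℝ) ^ (p * j) := by
    rw [pow_mul, pow_mul, hs, ← Real.rpow_mul_natCast hj0.le, hk]
    congr 1
    rw [← Real.rpow_natCast]
    congr 1
    push_cast
    field_simp
  have hsphere : ∀ w ∈ sphere z s, ‖g w‖ ≤ A * Real.exp (B * (2 ^ k * (r ^ k + j))) := by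
    intro w hw
    refine (hgrowth w).trans ?_
    have hw' : ‖w‖ ≤ r + s := by
      rw [mem_sphere_iff_norm] at hw
      have := norm_add_le (w - z) z
      rw [sub_add_cancel] at this
      linarith
    gcongr
    rw [← hsk]
    exact (Real.rpow_le_rpow (norm_nonneg _) hw' hk0.le).trans
      (add_rpow_le_two_rpow_mul hr hspos.le hk0.le)
  have hcauchy := Complex.norm_iteratedDeriv_le_of_forall_mem_sphere_norm_le ((p + 1) * j) hspos
    hg.diffContOnCl hsphere
  have hfac : (((p + 1) * j).factorial : ℝ) ≤ j.factorial * (((p : ℝ) + 1) * j) ^ (p * j) := by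
    have h : ((p + 1) * j).factorial ≤ j.factorial * ((p + 1) * j) ^ (p * j) := by
      have hadd : (p + 1) * j = j + p * j := by ring
      rw [hadd, ← Nat.factorial_mul_ascFactorial]
      gcongr
      exact Nat.ascFactorial_le_pow_add _ _
    exact_mod_cast h
  refine hcauchy.trans ?_
  rw [hspow]
  calc (((p + 1) * j).factorial : ℝ) * (A * Real.exp (B * (2 ^ k * (r ^ k + j)))) / j ^ (p * j)
      ≤ j.factorial * (((p : ℝ) + 1) * j) ^ (p * j) *
        (A * Real.exp (B * (2 ^ k * (r ^ k + j)))) / j ^ (p * j) := by gcongr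
    _ = j.factorial * ((p : ℝ) + 1) ^ (p * j) * (A * Real.exp (B * (2 ^ k * (r ^ k + j)))) := by
        rw [mul_pow]
        field_simp
    _ = _ := by
        have hexp : Real.exp (B * (2 ^ k * (r ^ k + j))) =
            Real.exp (B * 2 ^ k * r ^ k) * Real.exp (B * 2 ^ k) ^ j := by
          rw [← Real.exp_nat_mul, ← Real.exp_add]
          ring_nf
        rw [hexp, mul_pow, ← pow_mul]
        ring

/-- For `q ≥ 2` and `φ` holomorphic on `D_R`, the solution
`u(t,z) = Σ_j φ^{(qj)}(z) t^j/j!` of `∂_t u = ∂_z^q u`, `u(0,·) = φ`, is analytic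
in `t` near the origin iff `φ` extends to an entire function of exponential
growth of order at most `q/(q-1)`. -/
theorem stmt9 (q : ℕ) (hq : 2 ≤ q) (R : ℝ) (hR : 0 < R) (φ : ℂ → ℂ)
    (hφ : DifferentiableOn ℂ φ (Metric.ball (0:ℂ) R)) :
    (∃ ρ > (0:ℝ), ∃ r : ℝ, 0 < r ∧ r < R ∧ ∀ t z : ℂ, ‖t‖ < ρ → ‖z‖ < r →
      Summable fun j : ℕ =>
        ‖iteratedDeriv (q * j) φ z‖ * ‖t‖ ^ j / (Nat.factorial j : ℝ)) ↔
    (∃ g : ℂ → ℂ, Differentiable ℂ g ∧ (∀ z ∈ Metric.ball (0:ℂ) R, g z = φ z) ∧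
      ∃ A > (0:ℝ), ∃ B > (0:ℝ), ∀ z : ℂ,
        ‖g z‖ ≤ A * Real.exp (B * ‖z‖ ^ ((q : ℝ) / ((q : ℝ) - 1)))) := by
  obtain ⟨p, rfl⟩ : ∃ p, q = p + 1 := ⟨q - 1, by omega⟩
  have hp : 1 ≤ p := by omega
  have hexp : (((p + 1 : ℕ) : ℝ)) / (((p + 1 : ℕ) : ℝ) - 1) = ((p : ℝ) + 1) / p := by
    push_cast
    rw [add_sub_cancel_right]
  rw [hexp]
  constructor
  · rintro ⟨ρ, hρ, r, hr, hrR, hsum⟩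
    exact exists_entire_extension_of_summable hp hφ hρ hr hrR hsum
  · rintro ⟨g, hg, hgφ, A, hA, B, hB, hgrowth⟩
    set k : ℝ := ((p : ℝ) + 1) / p with hk
    set D : ℝ := ((p : ℝ) + 1) ^ p * Real.exp (B * 2 ^ k)
    have hDpos : 0 < D := by positivity
    refine ⟨D⁻¹, inv_pos.2 hDpos, R / 2, half_pos hR, half_lt_self hR, fun t z ht hz => ?_⟩
    have hDt : D * ‖t‖ < 1 := by
      rw [← mul_inv_cancel₀ hDpos.ne']
      gcongr
    refine Summable.of_nonneg_of_le (fun j => by positivity) (fun j => ?_)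
      ((summable_geometric_of_lt_one (by positivity) hDt).mul_left
        (A * Real.exp (B * 2 ^ k * (R / 2) ^ k)))
    have hzR : z ∈ ball (0 : ℂ) R := by
      rw [mem_ball_zero_iff]
      linarith
    rw [← Set.EqOn.iteratedDeriv_of_isOpen hgφ isOpen_ball ((p + 1) * j) hzR]
    have h := norm_iteratedDeriv_le_of_exp_growth hp hg hA hB hk hgrowth hz.le j
    calc ‖iteratedDeriv ((p + 1) * j) g z‖ * ‖t‖ ^ j / (j.factorial : ℝ)
        ≤ A * Real.exp (B * 2 ^ k * (R / 2) ^ k) * D ^ j * j.factorial * ‖t‖ ^ j /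
          (j.factorial : ℝ) := by gcongr
      _ = _ := by
          rw [mul_pow D]
          field_simp
end

section
/- Let q ∈ ℕ, q ≥ 1, let k > 0, and let φ be holomorphic on a disc D_R = {z ∈ ℂ : |z| < R}. Then the following are equivalent: (i) there exists r ∈ (0, R) such that the series u(t,z) = Σ_{j=0}^∞ φ^{(qj)}(z) t^j / j! converges absolutely for all t ∈ ℂ and |z| < r, and for every r' ∈ (0, r) there exist A, B > 0 with |u(t,z)| ≤ A e^{B|t|^k} for all t ∈ ℂ and |z| ≤ r' (i.e. the solution of ∂_t u = ∂_z^q u, u(0,·) = φ, is entire in t of exponential growth of order at most k); (ii) φ extends to an entire function on ℂ with |φ(z)| ≤ A e^{B|z|^{kq/(k(q−1)+1)}} for all z ∈ ℂ and some A, B > 0. -/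
section NatPowSelf

lemma natCast_pow_self_pos (n : ℕ) : 0 < (n : ℝ) ^ n := by
  rcases n.eq_zero_or_pos with rfl | h
  · simp
  · positivity

lemma one_le_natCast_pow_self (n : ℕ) : 1 ≤ (n : ℝ) ^ n := by
  rcases n.eq_zero_or_pos with rfl | h
  · simp
  · exact one_le_pow₀ (by exact_mod_cast h)

lemma natCast_pow_self_le_exp_mul_factorial (n : ℕ) :
    (n : ℝ) ^ n ≤ Real.exp 1 ^ n * (Nat.factorial n : ℝ) := by
  have h := Real.pow_div_factorial_le_exp (n : ℝ) n.cast_nonneg n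
  rwa [div_le_iff₀ (by positivity), ← mul_one (n : ℝ), Real.exp_nat_mul, mul_one] at h

lemma factorial_le_natCast_pow_self (n : ℕ) : (Nat.factorial n : ℝ) ≤ (n : ℝ) ^ n := by
  exact_mod_cast Nat.factorial_le_pow n

lemma natCast_mul_pow_self (q j : ℕ) :
    ((q * j : ℕ) : ℝ) ^ (q * j) = ((q : ℝ) ^ q) ^ j * ((j : ℝ) ^ j) ^ q := by
  push_cast
  rw [mul_pow, pow_mul, mul_comm q j, pow_mul]

/-- The terms `y ^ n / n ^ (β n)` are dominated by `exp (β y ^ (1 / β))`. -/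
lemma pow_mul_natCast_pow_self_rpow_neg_le {β y : ℝ} (hβ : 0 < β) (hy : 0 ≤ y) (n : ℕ) :
    y ^ n * ((n : ℝ) ^ n) ^ (-β) ≤ Real.exp (β * y ^ (1 / β)) := by
  have hP := natCast_pow_self_pos n
  have hw : 0 ≤ y ^ (1 / β) := by positivity
  have h : (y ^ (1 / β)) ^ n / (n : ℝ) ^ n ≤ Real.exp (y ^ (1 / β)) :=
    (div_le_div_of_nonneg_left (by positivity) (by positivity)
      (factorial_le_natCast_pow_self n)).trans (Real.pow_div_factorial_le_exp _ hw n)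
  have h2 := Real.rpow_le_rpow (by positivity) h hβ.le
  rw [← Real.exp_mul, mul_comm (y ^ (1 / β)) β,
    Real.div_rpow (by positivity) hP.le, ← Real.rpow_natCast, ← Real.rpow_mul hy,
    ← Real.rpow_mul hy, show 1 / β * n * β = n by field_simp, Real.rpow_natCast] at h2
  rwa [Real.rpow_neg hP.le, ← div_eq_mul_inv]

/-- Optimization of a family of Cauchy estimates over the radius. -/
lemma le_of_forall_radius {M A B K : ℝ} (hA : 0 ≤ A) (hK : 0 < K) (n : ℕ)
    (h : ∀ ρ : ℝ, 0 < ρ → M ≤ A * Real.exp (B * ρ ^ K) / ρ ^ n) :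
    M ≤ A * Real.exp B * Real.exp B ^ n * ((n : ℝ) ^ n) ^ (-(1 / K)) := by
  have hn : (0 : ℝ) < n + 1 := by positivity
  refine (h ((n + 1 : ℝ) ^ (1 / K)) (by positivity)).trans ?_
  rw [← Real.rpow_mul hn.le, one_div_mul_cancel hK.ne', Real.rpow_one, mul_add, mul_one,
    add_comm, Real.exp_add, mul_comm B, Real.exp_nat_mul, Real.rpow_neg (by positivity),
    ← div_eq_mul_inv, ← mul_assoc]
  refine div_le_div_of_nonneg_left (by positivity)
    (Real.rpow_pos_of_pos (natCast_pow_self_pos n) _) ?_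
  rw [← Real.rpow_natCast (_ ^ (1 / K)), ← Real.rpow_mul hn.le, mul_comm (1 / K),
    Real.rpow_mul hn.le, Real.rpow_natCast]
  gcongr
  linarith

end NatPowSelf

section PowerSeries

lemma hasFPowerSeriesOnBall_tsum {c : ℕ → ℂ}
    (hc : ∀ ρ : ℝ, 0 ≤ ρ → Summable fun n => ‖c n‖ * ρ ^ n) :
    HasFPowerSeriesOnBall (fun t : ℂ => ∑' n, c n * t ^ n)
      (FormalMultilinearSeries.ofScalars ℂ c) 0 ⊤ := by
  have hr : (FormalMultilinearSeries.ofScalars ℂ c).radius = ⊤ :=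
    FormalMultilinearSeries.radius_eq_top_of_summable_norm _ fun r => by
      simpa [FormalMultilinearSeries.ofScalars_norm] using hc r r.2
  refine ⟨hr.ge, by simp, fun {y} _ => ?_⟩
  have hs : Summable fun n => c n * y ^ n :=
    Summable.of_norm (by simpa using hc ‖y‖ (norm_nonneg _))
  simpa [FormalMultilinearSeries.ofScalars_apply_eq, mul_comm] using hs.hasSum

lemma differentiable_tsum_pow {c : ℕ → ℂ}
    (hc : ∀ ρ : ℝ, 0 ≤ ρ → Summable fun n => ‖c n‖ * ρ ^ n) :
    Differentiable ℂ fun t : ℂ => ∑' n, c n * t ^ n := fun t =>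
  (hasFPowerSeriesOnBall_tsum hc).differentiableOn.differentiableAt (by simp)

lemma iteratedDeriv_tsum_pow_zero {c : ℕ → ℂ}
    (hc : ∀ ρ : ℝ, 0 ≤ ρ → Summable fun n => ‖c n‖ * ρ ^ n) (n : ℕ) :
    iteratedDeriv n (fun t : ℂ => ∑' n, c n * t ^ n) 0 = Nat.factorial n * c n := by
  have h := (hasFPowerSeriesOnBall_tsum hc).hasFPowerSeriesAt
  have h2 := congrArg (FormalMultilinearSeries.coeff · n)
    (h.eq_formalMultilinearSeries h.analyticAt.hasFPowerSeriesAt)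
  simp only [FormalMultilinearSeries.coeff_ofScalars] at h2
  rw [h2, mul_div_cancel₀ _ (by exact_mod_cast n.factorial_ne_zero)]

/-- Cauchy's inequality for the coefficients of an everywhere convergent power series. -/
lemma norm_coeff_le_of_forall_norm_tsum_le {c : ℕ → ℂ}
    (hc : ∀ ρ : ℝ, 0 ≤ ρ → Summable fun n => ‖c n‖ * ρ ^ n) {ρ M : ℝ} (hρ : 0 < ρ)
    (hM : ∀ t : ℂ, ‖t‖ = ρ → ‖∑' n, c n * t ^ n‖ ≤ M) (n : ℕ) : ‖c n‖ ≤ M / ρ ^ n := by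
  have h := Complex.norm_iteratedDeriv_le_of_forall_mem_sphere_norm_le n hρ
    (differentiable_tsum_pow hc).diffContOnCl (c := 0) (C := M) (fun t ht => hM t (by simpa using ht))
  rw [iteratedDeriv_tsum_pow_zero hc, norm_mul, Complex.norm_natCast, mul_div_assoc] at h
  exact le_of_mul_le_mul_left h (by positivity)

end PowerSeries

section IteratedDeriv

lemma iteratedDeriv_iteratedDeriv_add {𝕜 F : Type*} [NontriviallyNormedField 𝕜]
    [NormedAddCommGroup F] [NormedSpace 𝕜 F] (m n : ℕ) (f : 𝕜 → F) :
    iteratedDeriv (m + n) f = iteratedDeriv m (iteratedDeriv n f) := by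
  simp only [iteratedDeriv_eq_iterate, Function.iterate_add_apply]

lemma DifferentiableOn.iteratedDeriv_of_isOpen {f : ℂ → ℂ} {U : Set ℂ}
    (hf : DifferentiableOn ℂ f U) (hU : IsOpen U) (n : ℕ) :
    DifferentiableOn ℂ (iteratedDeriv n f) U := by
  induction n with
  | zero => simpa using hf
  | succ n ih => rw [iteratedDeriv_succ]; exact ih.deriv hU

end IteratedDeriv

section Estimates

lemma pow_mul_natCast_pow_self_rpow_neg_le_geometric {β y l : ℝ} (hβ : 0 < β) (hy : 0 ≤ y)
    (hl : 0 < l) (n : ℕ) :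
    y ^ n * ((n : ℝ) ^ n) ^ (-β) ≤ Real.exp (β * (l * y) ^ (1 / β)) * (1 / l) ^ n := by
  have h := pow_mul_natCast_pow_self_rpow_neg_le hβ (mul_nonneg hl.le hy) n
  rw [one_div_pow, mul_one_div, le_div_iff₀ (by positivity)]
  rw [mul_pow] at h
  linarith

lemma factorial_mul_ratio_le {q : ℕ} {K k : ℝ}
    (hKk : (q : ℝ) * (1 - 1 / K) = 1 - 1 / k) (hK : 0 < K) (j : ℕ) :
    (Nat.factorial (q * j) : ℝ) * (((q * j : ℕ) : ℝ) ^ (q * j)) ^ (-(1 / K)) / (Nat.factorial j : ℝ) ≤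
      ((q : ℝ) ^ q * Real.exp 1) ^ j * ((j : ℝ) ^ j) ^ (-(1 / k)) := by
  have hP := natCast_pow_self_pos j
  have hPq := natCast_pow_self_pos (q * j)
  have hq1 : (1 : ℝ) ≤ ((q : ℝ) ^ q) ^ j := one_le_pow₀ (one_le_natCast_pow_self q)
  rw [div_le_iff₀ (by positivity)]
  calc (Nat.factorial (q * j) : ℝ) * (((q * j : ℕ) : ℝ) ^ (q * j)) ^ (-(1 / K))
      ≤ ((q * j : ℕ) : ℝ) ^ (q * j) * (((q * j : ℕ) : ℝ) ^ (q * j)) ^ (-(1 / K)) := by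
        gcongr
        exact factorial_le_natCast_pow_self _
    _ = (((q * j : ℕ) : ℝ) ^ (q * j)) ^ (1 - 1 / K) := by
        rw [sub_eq_add_neg, Real.rpow_add hPq, Real.rpow_one]
    _ = (((q : ℝ) ^ q) ^ j) ^ (1 - 1 / K) * ((j : ℝ) ^ j) ^ (1 - 1 / k) := by
        rw [natCast_mul_pow_self, Real.mul_rpow (by positivity) (by positivity),
          ← Real.rpow_natCast (_ ^ j) q, ← Real.rpow_mul hP.le, hKk]
    _ ≤ ((q : ℝ) ^ q) ^ j * ((j : ℝ) ^ j * ((j : ℝ) ^ j) ^ (-(1 / k))) := by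
        rw [sub_eq_add_neg 1 (1 / k), Real.rpow_add hP, Real.rpow_one]
        gcongr
        exact Real.rpow_le_self_of_one_le hq1 (by linarith [one_div_pos.2 hK])
    _ ≤ ((q : ℝ) ^ q) ^ j * ((Real.exp 1 ^ j * (Nat.factorial j : ℝ)) * ((j : ℝ) ^ j) ^ (-(1 / k))) := by
        gcongr
        exact natCast_pow_self_le_exp_mul_factorial j
    _ = _ := by rw [mul_pow]; ring

lemma factorial_div_factorial_mul_le {q : ℕ} (k : ℝ) (j : ℕ) :
    (Nat.factorial j : ℝ) * ((j : ℝ) ^ j) ^ (-(1 / k)) / (Nat.factorial (q * j) : ℝ) ≤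
      (Real.exp 1 ^ q) ^ j * ((j : ℝ) ^ j) ^ (-((q : ℝ) - 1 + 1 / k)) := by
  have hP := natCast_pow_self_pos j
  have hq1 : (1 : ℝ) ≤ ((q : ℝ) ^ q) ^ j := one_le_pow₀ (one_le_natCast_pow_self q)
  rw [div_le_iff₀ (by positivity)]
  calc (Nat.factorial j : ℝ) * ((j : ℝ) ^ j) ^ (-(1 / k))
      ≤ (j : ℝ) ^ j * ((j : ℝ) ^ j) ^ (-(1 / k)) := by
        gcongr
        exact factorial_le_natCast_pow_self _
    _ = ((j : ℝ) ^ j) ^ (-((q : ℝ) - 1 + 1 / k)) * ((j : ℝ) ^ j) ^ q := by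
        rw [← Real.rpow_natCast (_ ^ j) q, ← Real.rpow_add hP]
        nth_rw 1 [← Real.rpow_one ((j : ℝ) ^ j)]
        rw [← Real.rpow_add hP]
        ring_nf
    _ ≤ ((j : ℝ) ^ j) ^ (-((q : ℝ) - 1 + 1 / k)) * (((q : ℝ) ^ q) ^ j * ((j : ℝ) ^ j) ^ q) := by
        gcongr
        exact le_mul_of_one_le_left (by positivity) hq1
    _ ≤ ((j : ℝ) ^ j) ^ (-((q : ℝ) - 1 + 1 / k)) * (Real.exp 1 ^ (q * j) * (Nat.factorial (q * j) : ℝ)) := by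
        rw [← natCast_mul_pow_self]
        gcongr
        exact natCast_pow_self_le_exp_mul_factorial _
    _ = _ := by rw [pow_mul]; ring

/-- Cauchy estimates for the derivatives of an entire function of exponential growth. -/
lemma norm_iteratedDeriv_le_of_exp_growth_s10 {g : ℂ → ℂ} (hg : Differentiable ℂ g) {A B K r : ℝ}
    (hA : 0 < A) (hB : 0 < B) (hK : 0 < K) (hr : 0 < r)
    (h : ∀ z, ‖g z‖ ≤ A * Real.exp (B * ‖z‖ ^ K)) {z : ℂ} (hz : ‖z‖ ≤ r) (n : ℕ) :
    ‖iteratedDeriv n g z‖ ≤ Nat.factorial n * (A * Real.exp (B * 2 ^ K * r ^ K) * Real.exp (B * 2 ^ K) *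
      Real.exp (B * 2 ^ K) ^ n * ((n : ℝ) ^ n) ^ (-(1 / K))) := by
  have hf : (0 : ℝ) < Nat.factorial n := by positivity
  rw [← div_le_iff₀' hf]
  refine le_of_forall_radius (by positivity) hK n fun ρ hρ => ?_
  rw [div_le_iff₀' hf, ← mul_div_assoc]
  refine Complex.norm_iteratedDeriv_le_of_forall_mem_sphere_norm_le n hρ hg.diffContOnCl
    fun w hw => (h w).trans ?_
  rw [mul_assoc A, ← Real.exp_add, mul_assoc B, mul_assoc B, ← mul_add B]
  have hw' : ‖w‖ ≤ 2 * max r ρ := by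
    have h1 : ‖w‖ ≤ ‖w - z‖ + ‖z‖ := by simpa using norm_add_le (w - z) z
    rw [mem_sphere_iff_norm] at hw
    linarith [le_max_left r ρ, le_max_right r ρ]
  have h3 : ‖w‖ ^ K ≤ 2 ^ K * r ^ K + 2 ^ K * ρ ^ K := by
    refine (Real.rpow_le_rpow (norm_nonneg _) hw' hK.le).trans ?_
    rw [Real.mul_rpow (by positivity) (by positivity), ← mul_add]
    gcongr
    rcases max_choice r ρ with h | h <;> rw [h]
    · exact le_add_of_nonneg_right (by positivity)
    · exact le_add_of_nonneg_left (by positivity)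
  gcongr

/-- Termwise estimate for the solution series when the initial datum has exponential growth. -/
lemma heat_term_le_of_exp_growth {q : ℕ} (hq : 1 ≤ q) {k K : ℝ} (hk : 0 < k) (hK : 0 < K)
    (hKk : (q : ℝ) * (1 - 1 / K) = 1 - 1 / k) {g : ℂ → ℂ} (hg : Differentiable ℂ g) {A B r : ℝ}
    (hA : 0 < A) (hB : 0 < B) (hr : 0 < r)
    (h : ∀ z, ‖g z‖ ≤ A * Real.exp (B * ‖z‖ ^ K)) :
    ∃ A' > 0, ∃ B' > 0, ∀ (x : ℝ) (z : ℂ), 0 ≤ x → ‖z‖ ≤ r → ∀ j : ℕ,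
      ‖iteratedDeriv (q * j) g z‖ * x ^ j / (Nat.factorial j : ℝ) ≤
        A' * Real.exp (B' * x ^ k) * (1 / 2) ^ j := by
  set D := Real.exp (B * 2 ^ K) with hD
  set C := D ^ q * ((q : ℝ) ^ q * Real.exp 1) with hC
  have hD0 : 0 < D := Real.exp_pos _
  have hC0 : 0 < C := by positivity
  refine ⟨A * Real.exp (B * 2 ^ K * r ^ K) * D, by positivity, 1 / k * (2 * C) ^ k,
    by positivity, fun x z hx hz j => ?_⟩
  have h1 := norm_iteratedDeriv_le_of_exp_growth_s10 hg hA hB hK hr h hz (q * j)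
  rw [← hD] at h1
  set A₁ := A * Real.exp (B * 2 ^ K * r ^ K) * D
  have hA₁ : 0 < A₁ := by positivity
  calc ‖iteratedDeriv (q * j) g z‖ * x ^ j / (Nat.factorial j : ℝ)
      ≤ (Nat.factorial (q * j) * (A₁ * D ^ (q * j) * (((q * j : ℕ) : ℝ) ^ (q * j)) ^ (-(1 / K)))) * x ^ j /
          (Nat.factorial j : ℝ) := by gcongr
    _ = A₁ * (D ^ q * x) ^ j *
          ((Nat.factorial (q * j) : ℝ) * (((q * j : ℕ) : ℝ) ^ (q * j)) ^ (-(1 / K)) / (Nat.factorial j : ℝ)) := by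
        rw [mul_pow, ← pow_mul]; ring
    _ ≤ A₁ * (D ^ q * x) ^ j *
          (((q : ℝ) ^ q * Real.exp 1) ^ j * ((j : ℝ) ^ j) ^ (-(1 / k))) := by
        gcongr
        exact factorial_mul_ratio_le hKk hK j
    _ = A₁ * ((C * x) ^ j * ((j : ℝ) ^ j) ^ (-(1 / k))) := by
        rw [hC, mul_pow, mul_pow, mul_pow, mul_pow, mul_pow]; ring
    _ ≤ A₁ * (Real.exp (1 / k * (2 * (C * x)) ^ (1 / (1 / k))) * (1 / 2) ^ j) := by
        refine mul_le_mul_of_nonneg_left ?_ hA₁.le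
        exact pow_mul_natCast_pow_self_rpow_neg_le_geometric (by positivity) (by positivity)
          two_pos j
    _ = _ := by
        rw [one_div_one_div, ← mul_assoc 2 C x, Real.mul_rpow (by positivity) hx]; ring_nf

lemma pow_le_exp_rpow {K x : ℝ} (hK : 0 < K) (hx : 0 ≤ x) {s q : ℕ} (hs : s ≤ q) :
    x ^ s ≤ Real.exp (q / K * x ^ K) := by
  have h1 : x ≤ Real.exp (x ^ K / K) := by
    rcases hx.eq_or_lt with rfl | h0
    · positivity
    · rw [← Real.log_le_iff_le_exp h0, le_div_iff₀ hK, mul_comm, ← Real.log_rpow h0]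
      exact (Real.log_le_sub_one_of_pos (by positivity)).trans (by linarith)
  calc x ^ s ≤ Real.exp (x ^ K / K) ^ s := by gcongr
    _ ≤ Real.exp (x ^ K / K) ^ q :=
        pow_le_pow_right₀ (Real.one_le_exp (by positivity)) hs
    _ = _ := by rw [← Real.exp_nat_mul]; ring_nf

/-- Termwise estimate for the Taylor series of the initial datum when the solution series is of
exponential growth in time. -/
lemma taylor_term_le_of_heat_exp_growth {q : ℕ} (hq : 1 ≤ q) {k K : ℝ} (hk : 0 < k) (hK : 0 < K)
    (hKk : K = q / ((q : ℝ) - 1 + 1 / k)) {R r : ℝ} {φ : ℂ → ℂ}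
    (hφ : DifferentiableOn ℂ φ (Metric.ball 0 R)) (hr : 0 < r) (hrR : r < R)
    (hs : ∀ t z : ℂ, ‖z‖ ≤ r →
      Summable fun j : ℕ => ‖iteratedDeriv (q * j) φ z‖ * ‖t‖ ^ j / (Nat.factorial j : ℝ))
    {A B : ℝ} (hA : 0 < A)
    (hu : ∀ t z : ℂ, ‖z‖ ≤ r →
      ‖∑' j : ℕ, iteratedDeriv (q * j) φ z * t ^ j / (Nat.factorial j : ℂ)‖ ≤ A * Real.exp (B * ‖t‖ ^ k)) :
    ∃ A' > 0, ∃ B' > 0, ∀ (x : ℝ), 0 ≤ x → ∀ n : ℕ,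
      ‖iteratedDeriv n φ 0‖ / (Nat.factorial n : ℝ) * x ^ n ≤ A' * Real.exp (B' * x ^ K) * (1 / 2) ^ n := by
  set D := Real.exp B with hD
  have hD0 : 0 < D := Real.exp_pos _
  have hcoef : ∀ (z : ℂ), ‖z‖ ≤ r → ∀ j : ℕ, ‖iteratedDeriv (q * j) φ z‖ ≤
      Nat.factorial j * (A * D * D ^ j * ((j : ℝ) ^ j) ^ (-(1 / k))) := by
    intro z hz j
    rw [← div_le_iff₀' (by positivity)]
    refine le_of_forall_radius hA.le hk j fun ρ hρ => ?_
    have h := norm_coeff_le_of_forall_norm_tsum_le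
      (c := fun j => iteratedDeriv (q * j) φ z / (Nat.factorial j : ℂ)) (M := A * Real.exp (B * ρ ^ k))
      (fun ρ hρ => ?_) hρ (fun t ht => ?_) j
    · simpa using h
    · convert hs (ρ : ℂ) z hz using 2 with j
      simp [abs_of_nonneg hρ]; ring
    · rw [← ht]
      convert hu t z hz using 4
      ring
  set S := ∑ s ∈ Finset.range q, (Nat.factorial s : ℝ) / r ^ s with hS
  have hS0 : 0 < S := Finset.sum_pos (fun s _ => by positivity) ⟨0, Finset.mem_range.2 hq⟩
  have hderiv : ∀ j s : ℕ, s < q → ‖iteratedDeriv (q * j + s) φ 0‖ ≤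
      S * (Nat.factorial j * (A * D * D ^ j * ((j : ℝ) ^ j) ^ (-(1 / k)))) := by
    intro j s hsq
    rw [add_comm, iteratedDeriv_iteratedDeriv_add]
    have hd : DiffContOnCl ℂ (iteratedDeriv (q * j) φ) (Metric.ball 0 r) :=
      ((hφ.iteratedDeriv_of_isOpen Metric.isOpen_ball _).mono (by
        rw [closure_ball _ hr.ne']
        exact Metric.closedBall_subset_ball hrR)).diffContOnCl
    refine (Complex.norm_iteratedDeriv_le_of_forall_mem_sphere_norm_le s hr hd
      fun w hw => hcoef w (by simpa using (mem_sphere_zero_iff_norm.1 hw).le) j).trans ?_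
    rw [mul_div_right_comm]
    gcongr
    exact Finset.single_le_sum (f := fun s => (Nat.factorial s : ℝ) / r ^ s) (fun i _ => by positivity)
      (Finset.mem_range.2 hsq)
  have hq' : (1 : ℝ) ≤ q := by exact_mod_cast hq
  set β := (q : ℝ) - 1 + 1 / k with hβ
  have hβ0 : 0 < β := by
    have := one_div_pos.2 hk
    linarith
  clear_value β
  set C := D * Real.exp 1 ^ q with hC
  have hC0 : 0 < C := by positivity
  refine ⟨S * A * D * 2 ^ q, by positivity, q / K + β * (2 ^ q * C) ^ (1 / β), by positivity,
    fun x hx n => ?_⟩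
  obtain ⟨j, s, hsq, rfl⟩ : ∃ j s, s < q ∧ n = q * j + s :=
    ⟨n / q, n % q, Nat.mod_lt _ hq, (Nat.div_add_mod n q).symm⟩
  calc ‖iteratedDeriv (q * j + s) φ 0‖ / (Nat.factorial (q * j + s) : ℝ) * x ^ (q * j + s)
      ≤ S * (Nat.factorial j * (A * D * D ^ j * ((j : ℝ) ^ j) ^ (-(1 / k)))) / (Nat.factorial (q * j) : ℝ) *
          x ^ (q * j + s) := by
        gcongr
        · exact hderiv j s hsq
        · exact Nat.le_add_right _ _
    _ = S * A * D * x ^ s * ((D * x ^ q) ^ j *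
          ((Nat.factorial j : ℝ) * ((j : ℝ) ^ j) ^ (-(1 / k)) / (Nat.factorial (q * j) : ℝ))) := by
        rw [mul_pow, ← pow_mul, pow_add]; ring
    _ ≤ S * A * D * Real.exp (q / K * x ^ K) * ((D * x ^ q) ^ j *
          ((Real.exp 1 ^ q) ^ j * ((j : ℝ) ^ j) ^ (-β))) := by
        gcongr
        · exact pow_le_exp_rpow hK hx hsq.le
        · rw [hβ]
          exact factorial_div_factorial_mul_le k j
    _ = S * A * D * Real.exp (q / K * x ^ K) * ((C * x ^ q) ^ j * ((j : ℝ) ^ j) ^ (-β)) := by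
        rw [hC, mul_pow, mul_pow, mul_pow]; ring
    _ ≤ S * A * D * Real.exp (q / K * x ^ K) *
          (Real.exp (β * (2 ^ q * (C * x ^ q)) ^ (1 / β)) * (1 / 2 ^ q) ^ j) := by
        refine mul_le_mul_of_nonneg_left ?_ (by positivity)
        exact pow_mul_natCast_pow_self_rpow_neg_le_geometric hβ0 (by positivity) (by positivity) j
    _ = S * A * D * Real.exp ((q / K + β * (2 ^ q * C) ^ (1 / β)) * x ^ K) *
          (1 / 2) ^ (q * j) := by
        rw [← mul_assoc (2 ^ q) C, Real.mul_rpow (by positivity) (by positivity),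
          ← Real.rpow_natCast x q, ← Real.rpow_mul hx, mul_one_div, ← hKk, add_mul,
          Real.exp_add, pow_mul, one_div_pow 2 q, mul_assoc β]
        ring
    _ ≤ S * A * D * Real.exp ((q / K + β * (2 ^ q * C) ^ (1 / β)) * x ^ K) *
          (2 ^ q * (1 / 2) ^ (q * j + s)) := by
        gcongr
        rw [pow_add, mul_left_comm]
        refine le_mul_of_one_le_right (by positivity) ?_
        rw [one_div_pow, mul_one_div, one_le_div (by positivity)]
        exact pow_le_pow_right₀ (by norm_num) hsq.le
    _ = _ := by ring

end Estimates

lemma tsum_geometric_bound {a : ℕ → ℝ} {M : ℝ} (h0 : ∀ n, 0 ≤ a n)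
    (h : ∀ n, a n ≤ M * (1 / 2) ^ n) : Summable a ∧ ∑' n, a n ≤ M * 2 := by
  have hs := summable_geometric_two.mul_left M
  have ha := Summable.of_nonneg_of_le h0 h hs
  refine ⟨ha, (ha.tsum_le_tsum h hs).trans_eq ?_⟩
  rw [tsum_mul_left, tsum_geometric_two]


/-- For `q ≥ 1`, `k > 0` and `φ` holomorphic on `D_R`, the solution
`u(t,z) = Σ_j φ^{(qj)}(z) t^j/j!` of `∂_t u = ∂_z^q u`, `u(0,·) = φ`, is entire
in `t` of exponential growth of order at most `k` iff `φ` extends to an entire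
function of exponential growth of order at most `kq/(k(q-1)+1)`. -/
theorem stmt10 (q : ℕ) (hq : 1 ≤ q) (k : ℝ) (hk : 0 < k)
    (R : ℝ) (hR : 0 < R) (φ : ℂ → ℂ)
    (hφ : DifferentiableOn ℂ φ (Metric.ball (0:ℂ) R)) :
    (∃ r : ℝ, 0 < r ∧ r < R ∧
      (∀ t z : ℂ, ‖z‖ < r →
        Summable fun j : ℕ =>
          ‖iteratedDeriv (q * j) φ z‖ * ‖t‖ ^ j / (Nat.factorial j : ℝ)) ∧
      (∀ r' : ℝ, 0 < r' → r' < r → ∃ A > (0:ℝ), ∃ B > (0:ℝ), ∀ t z : ℂ, ‖z‖ ≤ r' →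
        ‖∑' j : ℕ, iteratedDeriv (q * j) φ z * t ^ j / (Nat.factorial j : ℂ)‖ ≤
          A * Real.exp (B * ‖t‖ ^ k))) ↔
    (∃ g : ℂ → ℂ, Differentiable ℂ g ∧ (∀ z ∈ Metric.ball (0:ℂ) R, g z = φ z) ∧
      ∃ A > (0:ℝ), ∃ B > (0:ℝ), ∀ z : ℂ,
        ‖g z‖ ≤ A * Real.exp (B * ‖z‖ ^ (k * (q : ℝ) / (k * ((q : ℝ) - 1) + 1)))) := by
  have hq' : (1 : ℝ) ≤ q := by exact_mod_cast hq
  have hden : 0 < k * ((q : ℝ) - 1) + 1 := by nlinarith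
  set K := k * (q : ℝ) / (k * ((q : ℝ) - 1) + 1) with hKdef
  have hK : 0 < K := by positivity
  constructor
  · rintro ⟨r, hr, hrR, hs, hu⟩
    obtain ⟨A, hA, B, hB, hu⟩ := hu (r / 2) (by linarith) (by linarith)
    have hKk : K = q / ((q : ℝ) - 1 + 1 / k) := by
      rw [hKdef, ← mul_div_mul_left (q : ℝ) _ hk.ne', mul_add, mul_one_div_cancel hk.ne']
    obtain ⟨A', hA', B', hB', h⟩ := taylor_term_le_of_heat_exp_growth hq hk hK hKk hφ
      (half_pos hr) (by linarith) (fun t z hz => hs t z (by linarith)) hA hu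
    have hterm : ∀ (z : ℂ) (n : ℕ),
        ‖(Nat.factorial n : ℂ)⁻¹ * iteratedDeriv n φ 0 * z ^ n‖ =
          ‖iteratedDeriv n φ 0‖ / (Nat.factorial n : ℝ) * ‖z‖ ^ n := by
      intro z n
      simp only [norm_mul, norm_inv, norm_pow, Complex.norm_natCast]
      ring
    refine ⟨fun z => ∑' n : ℕ, (Nat.factorial n : ℂ)⁻¹ * iteratedDeriv n φ 0 * z ^ n,
      differentiable_tsum_pow fun ρ hρ => ?_, fun z hz => ?_, A' * 2, by positivity, B', hB',
      fun z => ?_⟩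
    · refine (tsum_geometric_bound (M := A' * Real.exp (B' * ρ ^ K))
        (fun n => by positivity) fun n => ?_).1
      convert h ρ hρ n using 2
      simp [div_eq_inv_mul]
    · simpa using Complex.taylorSeries_eq_on_ball' hz hφ
    · obtain ⟨h1, h2⟩ := tsum_geometric_bound (fun n => by positivity) (h ‖z‖ (norm_nonneg z))
      simp only [← hterm] at h1 h2
      exact (norm_tsum_le_tsum_norm h1).trans (h2.trans_eq (by ring))
  · rintro ⟨g, hg, hgφ, A, hA, B, hB, hgrowth⟩
    have hKk : (q : ℝ) * (1 - 1 / K) = 1 - 1 / k := by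
      rw [hKdef]
      field_simp
      ring
    obtain ⟨A', hA', B', hB', h⟩ :=
      heat_term_le_of_exp_growth hq hk hK hKk hg hA hB (half_pos hR) hgrowth
    have hderiv : ∀ n (z : ℂ), ‖z‖ ≤ R / 2 → iteratedDeriv n φ z = iteratedDeriv n g z := by
      intro n z hz
      refine (Set.EqOn.iteratedDeriv_of_isOpen hgφ Metric.isOpen_ball n ?_).symm
      rw [mem_ball_zero_iff]
      linarith
    have hbound : ∀ t z : ℂ, ‖z‖ ≤ R / 2 →
        (Summable fun j : ℕ => ‖iteratedDeriv (q * j) φ z‖ * ‖t‖ ^ j / (Nat.factorial j : ℝ)) ∧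
        ∑' j : ℕ, ‖iteratedDeriv (q * j) φ z‖ * ‖t‖ ^ j / (Nat.factorial j : ℝ) ≤
          A' * Real.exp (B' * ‖t‖ ^ k) * 2 := fun t z hz =>
      tsum_geometric_bound (fun j => by positivity) fun j => by
        rw [hderiv _ z hz]
        exact h ‖t‖ z (norm_nonneg t) hz j
    refine ⟨R / 2, half_pos hR, half_lt_self hR, fun t z hz => (hbound t z hz.le).1,
      fun r' _ hr' => ⟨A' * 2, by positivity, B', hB', fun t z hz => ?_⟩⟩
    obtain ⟨h1, h2⟩ := hbound t z (hz.trans hr'.le)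
    have hterm : ∀ j : ℕ, ‖iteratedDeriv (q * j) φ z * t ^ j / (Nat.factorial j : ℂ)‖ =
        ‖iteratedDeriv (q * j) φ z‖ * ‖t‖ ^ j / (Nat.factorial j : ℝ) := by
      intro j
      simp only [norm_mul, norm_div, norm_pow, Complex.norm_natCast]
    simp only [← hterm] at h1 h2
    exact (norm_tsum_le_tsum_norm h1).trans (h2.trans_eq (by ring))
end

section
/- Let q ∈ ℕ, q ≥ 1, let s < 0, and let φ : ℂ → ℂ be an entire function such that |φ(z)| ≤ A e^{B|z|^{−1/s}} for all z ∈ ℂ and some A, B > 0 (i.e. φ is the sum of a series of Gevrey order s < 0). Then there exist r > 0 and constants A', B' > 0 such that sup_{|z| ≤ r} |φ^{(qj)}(z)| ≤ A' B'^j Γ_{q(1+s)}(j) for every j ∈ ℕ. -/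
open Real MeasureTheory Set

/-- A Stirling-type lower bound for the Gamma function. -/
theorem rpow_self_mul_exp_neg_le_Gamma_one_add {x : ℝ} (hx : 0 ≤ x) :
    x ^ x * exp (-x) ≤ Gamma (1 + x) := by
  have hint : IntegrableOn (fun t : ℝ => exp (-t) * t ^ x) (Ioi 0) := by
    simpa using GammaIntegral_convergent (show 0 < 1 + x by linarith)
  rw [Gamma_eq_integral (by linarith), ← integral_exp_neg_Ioi, ← integral_const_mul]
  simp only [add_sub_cancel_left]
  have hsub : Ioi x ⊆ Ioi 0 := Ioi_subset_Ioi hx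
  calc ∫ t in Ioi x, x ^ x * exp (-t)
      ≤ ∫ t in Ioi x, exp (-t) * t ^ x := by
        refine setIntegral_mono_on ((integrableOn_exp_neg_Ioi x).const_mul _)
          (hint.mono_set hsub) measurableSet_Ioi fun t ht => ?_
        rw [mul_comm]
        gcongr
        exact le_of_lt ht
    _ ≤ ∫ t in Ioi 0, exp (-t) * t ^ x := by
        refine setIntegral_mono_set hint ?_ hsub.eventuallyLE
        filter_upwards [ae_restrict_mem measurableSet_Ioi] with t ht
        have : (0 : ℝ) < t := ht
        simp only [Pi.zero_apply]
        positivity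

/-- A Stirling-type upper bound for the Gamma function. -/
theorem Gamma_one_add_le_two_mul_rpow {x : ℝ} (hx : 0 < x) :
    Gamma (1 + x) ≤ 2 * (2 * x) ^ x := by
  have hint : IntegrableOn (fun t : ℝ => exp (-t) * t ^ x) (Ioi 0) := by
    simpa using GammaIntegral_convergent (show 0 < 1 + x by linarith)
  have hexp : IntegrableOn (fun t : ℝ => exp (-(1 / 2) * t)) (Ioi 0) :=
    integrableOn_exp_mul_Ioi (by norm_num) 0
  have hval : ∫ t in Ioi (0 : ℝ), (2 * x) ^ x * exp (-(1 / 2) * t) = 2 * (2 * x) ^ x := by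
    rw [integral_const_mul, integral_exp_mul_Ioi (by norm_num) 0, mul_comm 2 ((2 * x) ^ x)]
    norm_num
  rw [Gamma_eq_integral (by linarith), ← hval]
  simp only [add_sub_cancel_left]
  refine setIntegral_mono_on hint (hexp.const_mul _) measurableSet_Ioi fun t ht => ?_
  have ht : 0 < t := ht
  have hpow : t ^ x ≤ (2 * x) ^ x * exp (t / 2) := by
    have hle : t ≤ 2 * x * exp (t / (2 * x)) := by
      have h := add_one_le_exp (t / (2 * x))
      calc t = 2 * x * (t / (2 * x)) := by field_simp
        _ ≤ 2 * x * exp (t / (2 * x)) := by gcongr; linarith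
    calc t ^ x ≤ (2 * x * exp (t / (2 * x))) ^ x := by gcongr
      _ = (2 * x) ^ x * exp (t / 2) := by
        rw [mul_rpow (by positivity) (exp_pos _).le, ← exp_mul]
        congr 2
        field_simp
  calc exp (-t) * t ^ x ≤ exp (-t) * ((2 * x) ^ x * exp (t / 2)) := by gcongr
    _ = (2 * x) ^ x * (exp (-t) * exp (t / 2)) := by ring
    _ = (2 * x) ^ x * exp (-(1 / 2) * t) := by
      rw [← exp_add]
      congr 2
      ring

/-- Up to a geometric factor, `j ^ (σ j)` is bounded by `GammaS σ j`. -/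
theorem exists_rpow_mul_le_GammaS (σ : ℝ) :
    ∃ K > (0 : ℝ), ∀ j : ℕ, (j : ℝ) ^ (σ * j) ≤ 2 * K ^ j * GammaS σ j := by
  rcases lt_trichotomy σ 0 with hσ | rfl | hσ
  · have hμ : 0 < -σ := neg_pos.2 hσ
    refine ⟨(2 * -σ) ^ (-σ), by positivity, fun j => ?_⟩
    rw [GammaS, if_neg hσ.not_ge]
    rcases j.eq_zero_or_pos with rfl | hj
    · simp
    have hj : (0 : ℝ) < j := Nat.cast_pos.2 hj
    have hG := Gamma_one_add_le_two_mul_rpow (mul_pos hμ hj)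
    have hpos : 0 < Gamma (1 - σ * j) := Gamma_pos_of_pos (by nlinarith)
    rw [← div_eq_mul_inv, le_div_iff₀ hpos]
    calc (j : ℝ) ^ (σ * j) * Gamma (1 - σ * j)
        = (j : ℝ) ^ (σ * j) * Gamma (1 + -σ * j) := by congr 2; ring
      _ ≤ (j : ℝ) ^ (σ * j) * (2 * (2 * (-σ * j)) ^ (-σ * j)) := by gcongr
      _ = 2 * ((2 * -σ) ^ (-σ)) ^ j * ((j : ℝ) ^ (σ * j) * (j : ℝ) ^ (-σ * j)) := by
        rw [← mul_assoc 2 (-σ), mul_rpow (by positivity) hj.le, rpow_mul (by positivity) (-σ) j,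
          rpow_natCast ((2 * -σ) ^ (-σ))]
        ring
      _ = 2 * ((2 * -σ) ^ (-σ)) ^ j := by
        rw [← rpow_add hj]
        simp
  · exact ⟨1, one_pos, fun j => by simp [GammaS]⟩
  · refine ⟨(exp 1 / σ) ^ σ, by positivity, fun j => ?_⟩
    rw [GammaS, if_pos hσ.le]
    have hG := rpow_self_mul_exp_neg_le_Gamma_one_add (x := σ * j) (by positivity)
    have hpos : 0 < Gamma (1 + σ * j) := Gamma_pos_of_pos (by positivity)
    calc (j : ℝ) ^ (σ * j)
        = ((exp 1 / σ) ^ σ) ^ j * ((σ * j) ^ (σ * j) * exp (-(σ * j))) := by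
          rw [← rpow_natCast ((exp 1 / σ) ^ σ), ← rpow_mul (by positivity),
            div_rpow (exp_pos _).le hσ.le, ← exp_mul, mul_rpow hσ.le j.cast_nonneg, exp_neg,
            one_mul]
          field_simp
      _ ≤ ((exp 1 / σ) ^ σ) ^ j * Gamma (1 + σ * j) := by gcongr
      _ ≤ 2 * ((exp 1 / σ) ^ σ) ^ j * Gamma (1 + σ * j) := by
          rw [mul_assoc 2]
          exact le_mul_of_one_le_left (by positivity) one_le_two

/-- Cauchy estimates, on the unit disc, for an entire function of finite exponential order. -/
theorem norm_iteratedDeriv_le_of_exp_growth_s14 {s : ℝ} (hs : s < 0) {φ : ℂ → ℂ}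
    (hφ : Differentiable ℂ φ) {A B : ℝ} (hA : 0 < A) (hB : 0 < B)
    (hbound : ∀ z : ℂ, ‖φ z‖ ≤ A * exp (B * ‖z‖ ^ (-1 / s))) (n : ℕ) {z : ℂ} (hz : ‖z‖ ≤ 1) :
    ‖iteratedDeriv n φ z‖ ≤
      A * exp B * exp (B * 2 ^ (-1 / s)) ^ n * (n : ℝ) ^ ((1 + s) * n) := by
  have hexpo : 0 < -1 / s := div_pos_of_neg_of_neg (by norm_num) hs
  rcases n.eq_zero_or_pos with rfl | hn
  · simp only [iteratedDeriv_zero, pow_zero, Nat.cast_zero, mul_zero, rpow_zero, mul_one]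
    refine (hbound z).trans ?_
    gcongr
    exact mul_le_of_le_one_right hB.le (rpow_le_one (norm_nonneg z) hz hexpo.le)
  have hn1 : (1 : ℝ) ≤ n := Nat.one_le_cast.2 hn
  have hn0 : (0 : ℝ) < n := by linarith
  set R : ℝ := (n : ℝ) ^ (-s) with hR
  have hR1 : 1 ≤ R := one_le_rpow hn1 (by linarith)
  have hR0 : 0 < R := by linarith
  have hRpow : (2 * R) ^ (-1 / s) = 2 ^ (-1 / s) * n := by
    rw [mul_rpow zero_le_two hR0.le, hR, ← rpow_mul hn0.le]
    have : -s * (-1 / s) = 1 := by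
      have := hs.ne
      field_simp
    rw [this, rpow_one]
  have hC : ∀ w ∈ Metric.sphere z R, ‖φ w‖ ≤ A * exp (B * 2 ^ (-1 / s)) ^ n := by
    intro w hw
    have hw2 : ‖w‖ ≤ 2 * R := by
      have h : ‖w - z‖ = R := by simpa [dist_eq_norm] using hw
      have := norm_le_norm_add_norm_sub' w z
      linarith
    calc ‖φ w‖ ≤ A * exp (B * ‖w‖ ^ (-1 / s)) := hbound w
      _ ≤ A * exp (B * (2 * R) ^ (-1 / s)) := by gcongr
      _ = A * exp (B * 2 ^ (-1 / s)) ^ n := by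
        rw [hRpow, ← exp_nat_mul]
        congr 2
        ring
  have hfact : (n.factorial : ℝ) ≤ (n : ℝ) ^ ((1 + s) * n) * R ^ n := by
    rw [hR, ← rpow_natCast ((n : ℝ) ^ (-s)), ← rpow_mul hn0.le, ← rpow_add hn0,
      show (1 + s) * n + -s * n = n by ring, rpow_natCast]
    exact_mod_cast n.factorial_le_pow
  calc ‖iteratedDeriv n φ z‖
      ≤ n.factorial * (A * exp (B * 2 ^ (-1 / s)) ^ n) / R ^ n :=
        Complex.norm_iteratedDeriv_le_of_forall_mem_sphere_norm_le n hR0 hφ.diffContOnCl hC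
    _ ≤ A * exp (B * 2 ^ (-1 / s)) ^ n * (n : ℝ) ^ ((1 + s) * n) := by
        rw [div_le_iff₀ (by positivity), mul_comm, mul_assoc (A * _)]
        gcongr
    _ ≤ A * exp B * exp (B * 2 ^ (-1 / s)) ^ n * (n : ℝ) ^ ((1 + s) * n) := by
        gcongr
        exact le_mul_of_one_le_right hA.le (one_le_exp hB.le)

/-- If `φ` is entire with `|φ(z)| ≤ A e^{B|z|^{-1/s}}` (`s < 0`), then the
iterates of `∂_z^q` applied to `φ` satisfy
`sup_{|z|≤r} |φ^{(qj)}(z)| ≤ A' B'^j Γ_{q(1+s)}(j)` for some `r > 0`. -/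
theorem stmt14 (q : ℕ) (hq : 1 ≤ q) (s : ℝ) (hs : s < 0)
    (φ : ℂ → ℂ) (hφ : Differentiable ℂ φ)
    (A B : ℝ) (hA : 0 < A) (hB : 0 < B)
    (hbound : ∀ z : ℂ, ‖φ z‖ ≤ A * Real.exp (B * ‖z‖ ^ (-1 / s))) :
    ∃ r > (0:ℝ), ∃ A' > (0:ℝ), ∃ B' > (0:ℝ), ∀ j : ℕ, ∀ z : ℂ, ‖z‖ ≤ r →
      ‖iteratedDeriv (q * j) φ z‖ ≤ A' * B' ^ j * GammaS ((q : ℝ) * (1 + s)) j := by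
  obtain ⟨K, hK, hΓ⟩ := exists_rpow_mul_le_GammaS ((q : ℝ) * (1 + s))
  have hq0 : (0 : ℝ) < q := Nat.cast_pos.2 hq
  set σ : ℝ := (q : ℝ) * (1 + s) with hσ
  set C : ℝ := exp (B * 2 ^ (-1 / s))
  have hC0 : 0 < C := exp_pos _
  refine ⟨1, one_pos, 2 * (A * exp B), by positivity, C ^ q * (q : ℝ) ^ σ * K, by positivity,
    fun j z hz => ?_⟩
  have hsplit : ((q * j : ℕ) : ℝ) ^ ((1 + s) * (q * j : ℕ)) =
      ((q : ℝ) ^ σ) ^ j * (j : ℝ) ^ (σ * j) := by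
    have hexpo : (1 + s) * ((q : ℝ) * j) = σ * j := by rw [hσ]; ring
    rw [Nat.cast_mul, hexpo, mul_rpow hq0.le j.cast_nonneg, rpow_mul hq0.le, rpow_natCast]
  calc ‖iteratedDeriv (q * j) φ z‖
      ≤ A * exp B * C ^ (q * j) * ((q * j : ℕ) : ℝ) ^ ((1 + s) * (q * j : ℕ)) :=
        norm_iteratedDeriv_le_of_exp_growth_s14 hs hφ hA hB hbound (q * j) hz
    _ = A * exp B * (C ^ q * (q : ℝ) ^ σ) ^ j * (j : ℝ) ^ (σ * j) := by
        rw [hsplit, pow_mul, mul_pow]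
        ring
    _ ≤ A * exp B * (C ^ q * (q : ℝ) ^ σ) ^ j * (2 * K ^ j * GammaS σ j) := by
        gcongr
        exact hΓ j
    _ = 2 * (A * exp B) * (C ^ q * (q : ℝ) ^ σ * K) ^ j * GammaS σ j := by
        rw [mul_pow _ K]
        ring
end
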